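/- arXiv:1708.09775 — 6 statements merged into one kernel-verified Lean document; each statement's English description precedes it below -/
import Mathlib

section
/- Let d ≥ 1 be an integer, U ⊆ ℝ^d an open neighborhood of a point x∞, and E : U → ℝ a real analytic function with E'(x∞) = 0. Then there exist constants C₃ ∈ (0,∞), σ₁ ∈ (0,1] with B_{σ₁}(x∞) ⊆ U, δ₁ ∈ (0, σ₁/4], and γ ∈ [1/2,∞) such that ‖E'(x)‖ ≥ C₃ · dist(x, B_{σ₁}(x∞) ∩ Crit E)^γ for all x ∈ B_{δ₁}(x∞). -/
section LojasiewiczDistance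

open Filter Topology

/-- The extension of a power series in finitely many real variables to a real Banach algebra `A`,
by substituting elements of `A` for the variables. -/
noncomputable def FormalMultilinearSeries.extendPi {ι : Type*} [Fintype ι] [DecidableEq ι]
    (p : FormalMultilinearSeries ℝ (ι → ℝ) ℝ) (A : Type*) [NormedRing A] [NormedAlgebra ℝ A] :
    FormalMultilinearSeries ℝ (ι → A) A := fun n =>
  ∑ I : Fin n → ι, p n (fun j => Pi.single (I j) 1) •
    (ContinuousMultilinearMap.mkPiAlgebraFin ℝ n A).compContinuousLinearMap
      (fun j => ContinuousLinearMap.proj (I j))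

section ExtendPi

variable {ι : Type*} [Fintype ι] [DecidableEq ι] (p : FormalMultilinearSeries ℝ (ι → ℝ) ℝ)
  {A : Type*} [NormedRing A] [NormedAlgebra ℝ A]

lemma FormalMultilinearSeries.extendPi_apply (n : ℕ) (v : Fin n → ι → A) :
    p.extendPi A n v = ∑ I : Fin n → ι, p n (fun j => Pi.single (I j) 1) •
      (List.ofFn fun j => v j (I j)).prod := by
  simp [FormalMultilinearSeries.extendPi]

lemma FormalMultilinearSeries.apply_eq_sum_single (n : ℕ) (x : ι → ℝ) :
    p n (fun _ => x) = ∑ I : Fin n → ι, (∏ j, x (I j)) * p n (fun j => Pi.single (I j) 1) := by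
  have hx : x = ∑ i, x i • (Pi.single i 1 : ι → ℝ) := by
    ext k; simp [Finset.sum_apply, Pi.single_apply]
  conv_lhs => rw [hx]
  have := (p n).toMultilinearMap.map_sum
    (fun (_ : Fin n) (i : ι) => x i • (Pi.single i 1 : ι → ℝ))
  refine this.trans (Finset.sum_congr rfl fun I _ => ?_)
  exact (p n).map_smul_univ (fun j => x (I j)) (fun j => Pi.single (I j) 1)

lemma FormalMultilinearSeries.norm_extendPi_le [NormOneClass A] (n : ℕ) :
    ‖p.extendPi A n‖ ≤ (Fintype.card ι : ℝ) ^ n * ‖p n‖ := by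
  refine ContinuousMultilinearMap.opNorm_le_bound (by positivity) fun v => ?_
  rw [p.extendPi_apply]
  have : ∀ I ∈ (Finset.univ : Finset (Fin n → ι)),
      ‖p n (fun j => Pi.single (I j) 1) • (List.ofFn fun j => v j (I j)).prod‖
        ≤ ‖p n‖ * ∏ j, ‖v j‖ := by
    intro I _
    have h1 : ‖p n (fun j => Pi.single (I j) 1)‖ ≤ ‖p n‖ := by
      refine ((p n).le_opNorm _).trans ?_
      rw [Finset.prod_eq_one fun j _ => (Pi.norm_single (G := fun _ => ℝ) 1).trans norm_one,
        mul_one]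
    have h2 : ‖(List.ofFn fun j => v j (I j)).prod‖ ≤ ∏ j, ‖v j‖ := by
      refine (List.norm_prod_le _).trans ?_
      rw [List.map_ofFn, List.prod_ofFn]
      exact Finset.prod_le_prod (fun _ _ => norm_nonneg _) fun j _ => norm_le_pi_norm (v j) (I j)
    rw [norm_smul]
    gcongr
  refine (norm_sum_le_of_le _ this).trans ?_
  simp [mul_assoc]

lemma FormalMultilinearSeries.extendPi_radius_pos [NormOneClass A] (h : 0 < p.radius) :
    0 < (p.extendPi A).radius := by
  obtain ⟨C, r, hC, hr, hb⟩ := p.le_mul_pow_of_radius_pos h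
  obtain ⟨D, hD⟩ : ∃ D : NNReal, (D : ℝ) = Fintype.card ι * r + 1 :=
    ⟨⟨Fintype.card ι * r + 1, by positivity⟩, rfl⟩
  have hD0 : (0 : ℝ) < D := by rw [hD]; positivity
  have : ((D⁻¹ : NNReal) : ENNReal) ≤ (p.extendPi A).radius := by
    refine FormalMultilinearSeries.le_radius_of_bound _ C fun n => ?_
    rw [NNReal.coe_inv]
    calc ‖p.extendPi A n‖ * (D : ℝ)⁻¹ ^ n
        ≤ ((Fintype.card ι : ℝ) ^ n * (C * r ^ n)) * (D : ℝ)⁻¹ ^ n := by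
          gcongr
          exact (p.norm_extendPi_le n).trans (by gcongr; exact hb n)
      _ = C * ((Fintype.card ι * r) * (D : ℝ)⁻¹) ^ n := by rw [mul_pow, mul_pow]; ring
      _ ≤ C * 1 := by
          gcongr
          refine pow_le_one₀ (by positivity) ?_
          rw [← div_eq_mul_inv, div_le_one hD0, hD]; linarith
      _ = C := mul_one C
  refine lt_of_lt_of_le ?_ this
  rw [ENNReal.coe_pos]
  exact inv_pos.2 (by exact_mod_cast hD0)

lemma FormalMultilinearSeries.extendPi_smul (n : ℕ) (x : ι → ℝ) (b : A) :
    p.extendPi A n (fun _ i => x i • b) = p n (fun _ => x) • b ^ n := by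
  rw [p.extendPi_apply, p.apply_eq_sum_single, Finset.sum_smul]
  refine Finset.sum_congr rfl fun I _ => ?_
  have : (List.ofFn fun j => x (I j) • b).prod = (∏ j, x (I j)) • b ^ n := by
    induction n with
    | zero => simp
    | succ k ih =>
      rw [List.ofFn_succ, List.prod_cons, ih (fun j => I j.succ) (Finset.mem_univ _), Fin.prod_univ_succ, pow_succ']
      simp [smul_smul, mul_comm]
  rw [this, smul_smul, mul_comm]

lemma FormalMultilinearSeries.map_extendPi_apply {X : Type*} [NormedAddCommGroup X]
    [NormedSpace ℝ X] (n : ℕ) (x : ι → ℝ) (a : ι → X →L[ℝ] X) (φ : X →L[ℝ] ℝ)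
    (h : ∀ i v, φ (a i v) = x i * φ v) (v : X) :
    φ (p.extendPi (X →L[ℝ] X) n (fun _ => a) v) = p n (fun _ => x) * φ v := by
  rw [p.extendPi_apply, p.apply_eq_sum_single, Finset.sum_mul, sum_apply,
    map_sum]
  refine Finset.sum_congr rfl fun I _ => ?_
  have : ∀ v, φ ((List.ofFn fun j => a (I j)).prod v) = (∏ j, x (I j)) * φ v := by
    induction n with
    | zero => simp
    | succ k ih =>
      intro v
      rw [List.ofFn_succ, List.prod_cons, Fin.prod_univ_succ, mul_apply_eq_comp, h,
        ih (fun j => I j.succ) (Finset.mem_univ _), mul_assoc]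
  rw [_root_.smul_apply, map_smul, this, smul_eq_mul]
  ring

end ExtendPi

section NormedRing

variable {A : Type*} [NormedRing A]

lemma isUnit_one_add_of_norm_lt_one [HasSummableGeomSeries A] {x : A} (h : ‖x‖ < 1) :
    IsUnit (1 + x) := by
  simpa using isUnit_one_sub_of_norm_lt_one (x := -x) (by rwa [norm_neg])

lemma norm_pow_le_one_of_norm_le_one [NormOneClass A] {x : A} (h : ‖x‖ ≤ 1) (k : ℕ) :
    ‖x ^ k‖ ≤ 1 :=
  (norm_pow_le x k).trans (pow_le_one₀ (norm_nonneg _) h)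

end NormedRing

section Shift

open BoundedContinuousFunction

noncomputable def rightShift : (ℕ →ᵇ ℝ) →L[ℝ] (ℕ →ᵇ ℝ) :=
  LinearMap.mkContinuous
    { toFun := fun a => BoundedContinuousFunction.ofNormedAddCommGroupDiscrete
        (fun n => Nat.casesOn n (0 : ℝ) a) ‖a‖ (by
          intro n; cases n with
          | zero => simp
          | succ n => exact a.norm_coe_le_norm n)
      map_add' := by intro a b; ext n; cases n <;> simp
      map_smul' := by intro a b; ext n; cases n <;> simp } 1 (by
    intro a
    rw [one_mul]
    exact BoundedContinuousFunction.norm_le_of_nonempty.2 (by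
          intro n; cases n with
          | zero => simp
          | succ n => exact a.norm_coe_le_norm n))

noncomputable def leftShift : (ℕ →ᵇ ℝ) →L[ℝ] (ℕ →ᵇ ℝ) :=
  LinearMap.mkContinuous
    { toFun := fun a => BoundedContinuousFunction.ofNormedAddCommGroupDiscrete
        (fun n => a (n + 1)) ‖a‖ (fun n => a.norm_coe_le_norm (n + 1))
      map_add' := by intro a b; ext n; simp
      map_smul' := by intro a b; ext n; simp } 1 (by
    intro a
    rw [one_mul]
    exact BoundedContinuousFunction.norm_le_of_nonempty.2 (fun n => a.norm_coe_le_norm (n + 1)))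

@[simp] lemma rightShift_apply_zero (a : ℕ →ᵇ ℝ) : rightShift a 0 = 0 := rfl

@[simp] lemma rightShift_apply_succ (a : ℕ →ᵇ ℝ) (n : ℕ) : rightShift a (n + 1) = a n := rfl

@[simp] lemma leftShift_apply (a : ℕ →ᵇ ℝ) (n : ℕ) : leftShift a n = a (n + 1) := rfl

lemma norm_rightShift_le : ‖rightShift‖ ≤ 1 := LinearMap.mkContinuous_norm_le _ zero_le_one _

lemma norm_leftShift_le : ‖leftShift‖ ≤ 1 := LinearMap.mkContinuous_norm_le _ zero_le_one _

lemma rightShift_pow_apply (k n : ℕ) (a : ℕ →ᵇ ℝ) :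
    (rightShift ^ k) a n = if n < k then 0 else a (n - k) := by
  induction k generalizing n with
  | zero => simp
  | succ k ih =>
    rw [pow_succ', mul_apply_eq_comp]
    cases n with
    | zero => simp
    | succ n => rw [rightShift_apply_succ, ih]; simp

lemma leftShift_pow_apply (k n : ℕ) (a : ℕ →ᵇ ℝ) : (leftShift ^ k) a n = a (n + k) := by
  induction k generalizing n with
  | zero => simp
  | succ k ih =>
    rw [pow_succ', mul_apply_eq_comp, leftShift_apply, ih]
    congr 1; ring

lemma summable_mul_pow (a : ℕ →ᵇ ℝ) {τ : ℝ} (hτ : |τ| ≤ 1 / 2) :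
    Summable fun k => a k * τ ^ k := by
  refine Summable.of_norm_bounded (g := fun k => ‖a‖ * (1 / 2) ^ k)
    (summable_geometric_two.mul_left _) fun k => ?_
  rw [norm_mul, norm_pow, Real.norm_eq_abs τ]
  gcongr
  exact a.norm_coe_le_norm k

noncomputable def genFunEval (τ : ℝ) (hτ : |τ| ≤ 1 / 2) : (ℕ →ᵇ ℝ) →L[ℝ] ℝ :=
  LinearMap.mkContinuous
    { toFun := fun a => ∑' k, a k * τ ^ k
      map_add' := by
        intro a b
        rw [← (summable_mul_pow a hτ).tsum_add (summable_mul_pow b hτ)]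
        simp [add_mul]
      map_smul' := by
        intro c a
        simp [← tsum_mul_left, mul_assoc] } 2 (by
    intro a
    have h := tsum_of_norm_bounded (f := fun k => a k * τ ^ k)
      (hasSum_geometric_two.mul_left ‖a‖) (fun k => by
        rw [norm_mul, norm_pow, Real.norm_eq_abs τ]
        gcongr
        exact a.norm_coe_le_norm k)
    rw [mul_comm]; exact h)

noncomputable def unitSeq : ℕ →ᵇ ℝ :=
  BoundedContinuousFunction.ofNormedAddCommGroupDiscrete (fun n => if n = 0 then 1 else 0) 1
    (fun n => by split_ifs <;> simp)

lemma unitSeq_apply (n : ℕ) : unitSeq n = if n = 0 then 1 else 0 := rfl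

lemma norm_unitSeq_le : ‖unitSeq‖ ≤ 1 :=
  (BoundedContinuousFunction.norm_le zero_le_one).2 fun n => by
    rw [unitSeq_apply]; split_ifs <;> simp

instance : Nontrivial (ℕ →ᵇ ℝ) :=
  ⟨⟨unitSeq, 0, fun h => by simpa [unitSeq_apply] using DFunLike.congr_fun h 0⟩⟩

lemma norm_rightShift_pow_le (k : ℕ) : ‖rightShift ^ k‖ ≤ 1 :=
  norm_pow_le_one_of_norm_le_one (A := (ℕ →ᵇ ℝ) →L[ℝ] (ℕ →ᵇ ℝ)) norm_rightShift_le k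

lemma norm_leftShift_pow_le (k : ℕ) : ‖leftShift ^ k‖ ≤ 1 :=
  norm_pow_le_one_of_norm_le_one (A := (ℕ →ᵇ ℝ) →L[ℝ] (ℕ →ᵇ ℝ)) norm_leftShift_le k

lemma leftShift_pow_rightShift_pow (k : ℕ) (a : ℕ →ᵇ ℝ) :
    (leftShift ^ k) ((rightShift ^ k) a) = a := by
  ext n; rw [leftShift_pow_apply, rightShift_pow_apply]; simp

variable {τ : ℝ} (hτ : |τ| ≤ 1 / 2)

lemma genFunEval_apply (a : ℕ →ᵇ ℝ) : genFunEval τ hτ a = ∑' k, a k * τ ^ k := rfl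

lemma norm_genFunEval_apply_le (a : ℕ →ᵇ ℝ) : |genFunEval τ hτ a| ≤ 2 * ‖a‖ :=
  (genFunEval τ hτ).le_of_opNorm_le (LinearMap.mkContinuous_norm_le _ zero_le_two _) a

lemma genFunEval_rightShift (a : ℕ →ᵇ ℝ) :
    genFunEval τ hτ (rightShift a) = τ * genFunEval τ hτ a := by
  rw [genFunEval_apply, (summable_mul_pow _ hτ).tsum_eq_zero_add, genFunEval_apply,
    ← tsum_mul_left]
  simp only [rightShift_apply_zero, rightShift_apply_succ, zero_mul, zero_add]
  exact tsum_congr fun k => by ring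

lemma genFunEval_rightShift_pow (k : ℕ) (a : ℕ →ᵇ ℝ) :
    genFunEval τ hτ ((rightShift ^ k) a) = τ ^ k * genFunEval τ hτ a := by
  induction k with
  | zero => simp
  | succ k ih =>
    rw [pow_succ', mul_apply_eq_comp, genFunEval_rightShift, ih]; ring

lemma genFunEval_eq_sum_add (m : ℕ) (a : ℕ →ᵇ ℝ) :
    genFunEval τ hτ a = ∑ i : Fin m, a i * τ ^ (i : ℕ) +
      τ ^ m * genFunEval τ hτ ((leftShift ^ m) a) := by
  rw [genFunEval_apply, ← (summable_mul_pow a hτ).sum_add_tsum_nat_add m, genFunEval_apply,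
    ← tsum_mul_left, Fin.sum_univ_eq_sum_range (fun i => a i * τ ^ i)]
  congr 1
  exact tsum_congr fun k => by rw [leftShift_pow_apply]; ring

lemma genFunEval_unitSeq : genFunEval τ hτ unitSeq = 1 := by
  rw [genFunEval_apply, tsum_eq_single 0]
  · simp [unitSeq_apply]
  · intro k hk; simp [unitSeq_apply, hk]

lemma shift_division_eq {m : ℕ} {T : (ℕ →ᵇ ℝ) →L[ℝ] (ℕ →ᵇ ℝ)}
    (hT : ‖T - rightShift ^ m‖ ≤ 1 / 16) :
    IsUnit (1 + (T - rightShift ^ m) * leftShift ^ m) ∧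
    Ring.inverse (1 + (T - rightShift ^ m) * leftShift ^ m) ((rightShift ^ m) unitSeq) +
      (T - rightShift ^ m) ((leftShift ^ m)
        (Ring.inverse (1 + (T - rightShift ^ m) * leftShift ^ m) ((rightShift ^ m) unitSeq)))
      = (rightShift ^ m) unitSeq := by
  have hK : ‖(T - rightShift ^ m) * leftShift ^ m‖ ≤ 1 / 16 :=
    (norm_mul_le (T - rightShift ^ m) (leftShift ^ m)).trans <| by
      calc ‖T - rightShift ^ m‖ * ‖leftShift ^ m‖ ≤ 1 / 16 * 1 := by
            gcongr
            exact norm_leftShift_pow_le m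
        _ = 1 / 16 := mul_one _
  have hu : IsUnit (1 + (T - rightShift ^ m) * leftShift ^ m) := 
    isUnit_one_add_of_norm_lt_one (A := (ℕ →ᵇ ℝ) →L[ℝ] (ℕ →ᵇ ℝ))
      (lt_of_le_of_lt hK (by norm_num))
  refine ⟨hu, ?_⟩
  have := DFunLike.congr_fun (Ring.mul_inverse_cancel _ hu) ((rightShift ^ m) unitSeq)
  rw [mul_apply_eq_comp, _root_.add_apply, mul_apply_eq_comp] at this
  exact this

lemma shift_division {m : ℕ} {T : (ℕ →ᵇ ℝ) →L[ℝ] (ℕ →ᵇ ℝ)} {h : ℕ →ᵇ ℝ}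
    (hT : ‖T - rightShift ^ m‖ ≤ 1 / 16)
    (hh : h + (T - rightShift ^ m) ((leftShift ^ m) h) = (rightShift ^ m) unitSeq) :
    τ ^ m - ∑ i : Fin m, h i * τ ^ (i : ℕ) = genFunEval τ hτ (T ((leftShift ^ m) h)) ∧
      1 / 2 ≤ genFunEval τ hτ ((leftShift ^ m) h) ∧
      genFunEval τ hτ ((leftShift ^ m) h) ≤ 2 := by
  constructor
  · have := congrArg (genFunEval τ hτ) hh
    rw [map_add, _root_.sub_apply, map_sub, genFunEval_rightShift_pow, genFunEval_rightShift_pow,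
      genFunEval_unitSeq, genFunEval_eq_sum_add hτ m h] at this
    linarith
  · have hl : ‖(leftShift ^ m) h‖ ≤ ‖h‖ := by
      simpa using (leftShift ^ m).le_of_opNorm_le (norm_leftShift_pow_le m) h
    have hr : ‖(rightShift ^ m) unitSeq‖ ≤ 1 := by
      simpa using ((rightShift ^ m).le_of_opNorm_le (norm_rightShift_pow_le m) unitSeq).trans
        (by simpa using norm_unitSeq_le)
    have h1 : ‖(T - rightShift ^ m) ((leftShift ^ m) h)‖ ≤ 1 / 16 * ‖h‖ :=
      ((T - rightShift ^ m).le_of_opNorm_le hT _).trans (by gcongr)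
    have h2 : ‖h‖ ≤ 1 + 1 / 16 * ‖h‖ := by
      calc ‖h‖ = ‖(rightShift ^ m) unitSeq - (T - rightShift ^ m) ((leftShift ^ m) h)‖ := by
            rw [← hh, add_sub_cancel_right]
        _ ≤ _ := (norm_sub_le _ _).trans (add_le_add hr h1)
    have h3 : ‖(leftShift ^ m) h - unitSeq‖ ≤ 1 / 15 := by
      calc ‖(leftShift ^ m) h - unitSeq‖
          = ‖(leftShift ^ m) (h - (rightShift ^ m) unitSeq)‖ := by
            rw [map_sub, leftShift_pow_rightShift_pow]
        _ ≤ 1 * ‖h - (rightShift ^ m) unitSeq‖ :=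
            (leftShift ^ m).le_of_opNorm_le (norm_leftShift_pow_le m) _
        _ = ‖(T - rightShift ^ m) ((leftShift ^ m) h)‖ := by
            rw [← hh, sub_add_cancel_left, norm_neg, one_mul]
        _ ≤ 1 / 15 := by linarith
    have h4 := (norm_genFunEval_apply_le hτ ((leftShift ^ m) h - unitSeq))
    rw [map_sub, genFunEval_unitSeq, abs_le] at h4
    constructor <;> linarith

end Shift

section Weierstrass

lemma exists_operator_substitution {X : Type*} [NormedAddCommGroup X] [NormedSpace ℝ X]
    [CompleteSpace X] [Nontrivial X] {n m : ℕ} {f : (Fin (n + 1) → ℝ) → ℝ}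
    {p : FormalMultilinearSeries ℝ (Fin (n + 1) → ℝ) ℝ} (hf : HasFPowerSeriesAt f p 0)
    (hlt : ∀ k < m, p k (fun _ => Pi.single 0 1) = 0) {S : X →L[ℝ] X} (hS : ‖S‖ ≤ 1) :
    ∃ r > 0, ∃ G : ℝ → (Fin n → ℝ) → (X →L[ℝ] X),
      (∀ ρ, |ρ| < r → AnalyticAt ℝ (G ρ) 0) ∧
      (∀ ρ x τ, |ρ| < r → ‖x‖ < r → |τ| ≤ 1 → ∀ φ : X →L[ℝ] ℝ,
        (∀ v, φ (S v) = τ * φ v) → ∀ v, φ (G ρ x v) = f (Fin.cons (ρ * τ) x) * φ v) ∧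
      (∀ ρ, |ρ| < r → ∀ φ : X →L[ℝ] ℝ, ∀ v, (∀ k, m ≤ k → φ ((S ^ k) v) = 0) →
        φ (G ρ 0 v) = 0) ∧
      ∃ K, ∀ᶠ ρ in 𝓝 0,
        ‖G ρ 0 - (ρ ^ m * p m (fun _ => Pi.single 0 1)) • S ^ m‖ ≤ K * |ρ| ^ (m + 1) := by
  set c := p m (fun _ => Pi.single 0 1) with hc
  set q : FormalMultilinearSeries ℝ (Fin (n + 1) → (X →L[ℝ] X)) (X →L[ℝ] X) :=
    p.extendPi (X →L[ℝ] X) with hq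
  obtain ⟨r₀, hf⟩ := hf
  have hF := q.hasFPowerSeriesOnBall
    (p.extendPi_radius_pos (hf.r_pos.trans_le hf.r_le))
  have hFat := hF.hasFPowerSeriesAt
  set F := q.sum
  obtain ⟨r, hr0, hr⟩ : ∃ r : ℝ, 0 < r ∧ ENNReal.ofReal r < min r₀ q.radius := by
    obtain ⟨r, h1, h2⟩ := ENNReal.lt_iff_exists_nnreal_btwn.1 (lt_min hf.r_pos hF.r_pos)
    exact ⟨r, by exact_mod_cast h1, by simpa using h2⟩
  replace hf := hf.mono (by simpa using hr0) (hr.le.trans (min_le_left _ _))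
  replace hF := hF.mono (by simpa using hr0) (hr.le.trans (min_le_right _ _))
  set pt : ℝ → (Fin n → ℝ) → (Fin (n + 1) → (X →L[ℝ] X)) :=
    fun ρ x => Fin.cons (ρ • S) (fun i => x i • 1) with hpt
  have hmem : ∀ ρ x, |ρ| < r → ‖x‖ < r → pt ρ x ∈ Metric.eball 0 (ENNReal.ofReal r) := by
    intro ρ x h1 h2
    rw [Metric.eball_ofReal, mem_ball_zero_iff, pi_norm_lt_iff hr0]
    intro i
    refine Fin.cases ?_ (fun i => ?_) i
    · simp only [hpt, Fin.cons_zero]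
      calc ‖ρ • S‖ ≤ |ρ| * 1 := by
            rw [norm_smul, Real.norm_eq_abs]
            gcongr
        _ < r := by rwa [mul_one]
    · simp only [hpt, Fin.cons_succ, norm_smul, norm_one, mul_one]
      exact (norm_le_pi_norm x i).trans_lt h2
  have hmem' : ∀ (s : ℝ) (x : Fin n → ℝ), |s| < r → ‖x‖ < r →
      (Fin.cons s x : Fin (n + 1) → ℝ) ∈ Metric.eball 0 (ENNReal.ofReal r) := by
    intro s x h1 h2
    rw [Metric.eball_ofReal, mem_ball_zero_iff, pi_norm_lt_iff hr0]
    intro i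
    refine Fin.cases (by simpa using h1) (fun i => ?_) i
    simpa using (norm_le_pi_norm x i).trans_lt h2
  have hpt0 : ∀ ρ, pt ρ 0 = fun i => (Pi.single 0 ρ : Fin (n + 1) → ℝ) i • S := by
    intro ρ
    ext1 i
    refine Fin.cases ?_ (fun i => ?_) i
    · simp [hpt]
    · simp [hpt]
  have hterm : ∀ ρ k, q k (fun _ => pt ρ 0)
      = (ρ ^ k * p k (fun _ => Pi.single 0 1)) • S ^ k := by
    intro ρ k
    rw [hpt0, hq, p.extendPi_smul]
    congr 1
    have : (Pi.single 0 ρ : Fin (n + 1) → ℝ) = ρ • Pi.single 0 1 := by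
      rw [← Pi.single_smul]; simp
    rw [this]
    simpa using (p k).map_smul_univ (fun _ => ρ) (fun _ => Pi.single 0 1)
  have hpart : ∀ ρ, q.partialSum (m + 1) (pt ρ 0) = (ρ ^ m * c) • S ^ m := by
    intro ρ
    rw [FormalMultilinearSeries.partialSum, Finset.sum_range_succ, Finset.sum_eq_zero, zero_add,
      hterm]
    intro k hk
    rw [hterm, hlt k (Finset.mem_range.1 hk), mul_zero, zero_smul]
  have hsum : ∀ ρ x, |ρ| < r → ‖x‖ < r → HasSum (fun k => q k (fun _ => pt ρ x)) (F (pt ρ x)) := by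
    intro ρ x h1 h2
    simpa using hF.hasSum (hmem ρ x h1 h2)
  have happly : ∀ ρ x, |ρ| < r → ‖x‖ < r → ∀ (φ : X →L[ℝ] ℝ) v,
      HasSum (fun k => φ (q k (fun _ => pt ρ x) v)) (φ (F (pt ρ x) v)) := fun ρ x h1 h2 φ v =>
    ((hsum ρ x h1 h2).mapL (ContinuousLinearMap.apply ℝ X v)).mapL φ
  refine ⟨r, hr0, fun ρ x => F (pt ρ x), ?_, ?_, ?_, ?_⟩
  · intro ρ hρ
    have h1 : AnalyticAt ℝ (fun x : Fin n → ℝ => pt ρ x) 0 := by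
      refine AnalyticAt.pi (f := fun i x => pt ρ x i) fun i => ?_
      refine Fin.cases ?_ (fun i => ?_) i
      · simpa [hpt] using analyticAt_const
      · simp only [hpt, Fin.cons_succ]
        exact ((ContinuousLinearMap.proj (R := ℝ) (φ := fun _ : Fin n => ℝ) i).analyticAt 0).smul
          analyticAt_const
    exact (hF.analyticAt_of_mem (hmem ρ 0 hρ (by simpa using hr0))).comp h1
  · intro ρ x τ hρ hx hτ φ hφ v
    have hρτ : |ρ * τ| < r := by
      rw [abs_mul]; nlinarith [abs_nonneg τ, abs_nonneg ρ]
    have h1 := happly ρ x hρ hx φ v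
    have h2 : HasSum (fun k => p k (fun _ => Fin.cons (ρ * τ) x) * φ v)
        (f (Fin.cons (ρ * τ) x) * φ v) := by
      simpa using (hf.hasSum (hmem' _ x hρτ hx)).mul_right (φ v)
    refine h1.unique (h2.congr_fun fun k => ?_)
    refine p.map_extendPi_apply k _ _ φ (fun i w => ?_) v
    refine Fin.cases ?_ (fun i => ?_) i
    · simp [hpt, hφ, mul_assoc]
    · simp [hpt]
  · intro ρ hρ φ v hφ
    refine (happly ρ 0 hρ (by simpa using hr0) φ v).unique (hasSum_zero.congr_fun fun k => ?_)
    rw [hterm]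
    rcases lt_or_ge k m with hk | hk
    · simp [hlt k hk]
    · rw [_root_.smul_apply, map_smul, hφ k hk, smul_zero]
  · obtain ⟨K, hK⟩ := (hFat.isBigO_sub_partialSum_pow (m + 1)).bound
    have hle : ∀ ρ, ‖pt ρ 0‖ ≤ |ρ| := by
      intro ρ
      rw [pi_norm_le_iff_of_nonneg (abs_nonneg ρ), hpt0]
      intro i
      rw [norm_smul]
      calc _ ≤ |ρ| * 1 := by
            gcongr
            refine Fin.cases ?_ (fun i => ?_) i <;> simp
        _ = _ := mul_one _
    have ht : Tendsto (fun ρ => pt ρ 0) (𝓝 0) (𝓝 0) :=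
      squeeze_zero_norm hle (by simpa using (continuous_abs (G := ℝ)).tendsto 0)
    refine ⟨|K|, (ht.eventually hK).mono fun ρ h => ?_⟩
    rw [zero_add, hpart, norm_pow, norm_norm] at h
    refine h.trans ?_
    gcongr
    · exact le_abs_self K
    · exact hle ρ

lemma AnalyticAt.inverse_one_add_sub_mul {E A : Type*} [NormedAddCommGroup E] [NormedSpace ℝ E]
    [NormedRing A] [NormedAlgebra ℝ A] [CompleteSpace A] {T : E → A} {x₀ : E}
    (hT : AnalyticAt ℝ T x₀) {a b : A} (h : IsUnit (1 + (T x₀ - a) * b)) :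
    AnalyticAt ℝ (fun x => Ring.inverse (1 + (T x - a) * b)) x₀ := by
  obtain ⟨u, hu⟩ := h
  exact (analyticAt_inverse (𝕜 := ℝ) u).comp_of_eq
    (analyticAt_const.fun_add ((hT.fun_sub analyticAt_const).fun_mul analyticAt_const)) hu.symm

lemma ContinuousAt.eventually_norm_sub_lt {E A : Type*} [TopologicalSpace E]
    [SeminormedAddCommGroup A] {T : E → A} {x₀ : E} (hT : ContinuousAt T x₀) {a : A} {c : ℝ}
    (h : ‖T x₀ - a‖ < c) : ∀ᶠ x in 𝓝 x₀, ‖T x - a‖ < c :=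
  (hT.sub continuousAt_const).norm.eventually (gt_mem_nhds h)

open BoundedContinuousFunction

lemma exists_weierstrass_polynomial {n m : ℕ} {f : (Fin (n + 1) → ℝ) → ℝ}
    {p : FormalMultilinearSeries ℝ (Fin (n + 1) → ℝ) ℝ} (hf : HasFPowerSeriesAt f p 0)
    (hlt : ∀ k < m, p k (fun _ => Pi.single 0 1) = 0) (hm : p m (fun _ => Pi.single 0 1) ≠ 0) :
    ∃ ρ > 0, ∃ C > 0, ∃ a : Fin m → (Fin n → ℝ) → ℝ,
      (∀ i, AnalyticAt ℝ (a i) 0 ∧ a i 0 = 0) ∧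
      ∀ᶠ x in 𝓝 (0 : Fin n → ℝ), ∀ τ : ℝ, |τ| ≤ 1 / 2 →
        |τ ^ m + ∑ i, a i x * τ ^ (i : ℕ)| ≤ C * |f (Fin.cons (ρ * τ) x)| ∧
        (τ ^ m + ∑ i, a i x * τ ^ (i : ℕ) = 0 → f (Fin.cons (ρ * τ) x) = 0) := by
  obtain ⟨r, hr0, G, hGan, hGev, hG0, K, hK⟩ :=
    exists_operator_substitution hf hlt norm_rightShift_le
  set c := p m (fun _ => Pi.single 0 1)
  obtain ⟨ρ, hρ0, hρr, hρ⟩ : ∃ ρ : ℝ, 0 < ρ ∧ ρ < r ∧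
      ‖(ρ ^ m * c)⁻¹ • G ρ 0 - rightShift ^ m‖ < 1 / 16 := by
    have h1 : ∀ᶠ ρ in 𝓝 (0 : ℝ), |c|⁻¹ * K * |ρ| < 1 / 16 := by
      have : Continuous fun ρ : ℝ => |c|⁻¹ * K * |ρ| := by fun_prop
      exact this.continuousAt.eventually_lt continuousAt_const (by simp)
    obtain ⟨ρ, ⟨⟨h1, h2⟩, h3⟩, h4⟩ :=
      ((((h1.and hK).and (gt_mem_nhds hr0)).filter_mono nhdsWithin_le_nhds).and
        (self_mem_nhdsWithin (s := Set.Ioi (0 : ℝ)))).exists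
    have h4 : 0 < ρ := h4
    refine ⟨ρ, h4, h3, lt_of_le_of_lt ?_ h1⟩
    have hne : ρ ^ m * c ≠ 0 := mul_ne_zero (by positivity) hm
    have : (ρ ^ m * c)⁻¹ • G ρ 0 - rightShift ^ m
        = (ρ ^ m * c)⁻¹ • (G ρ 0 - (ρ ^ m * c) • rightShift ^ m) := by
      rw [smul_sub, inv_smul_smul₀ hne]
    rw [this, norm_smul]
    calc _ ≤ ‖(ρ ^ m * c)⁻¹‖ * (K * |ρ| ^ (m + 1)) := by gcongr
      _ = _ := by
        rw [norm_inv, norm_mul, norm_pow, Real.norm_eq_abs, Real.norm_eq_abs]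
        have : |ρ| ≠ 0 := by positivity
        field_simp
        ring
  have hcρ : ρ ^ m * c ≠ 0 := mul_ne_zero (by positivity) hm
  have hρr' : |ρ| < r := by rwa [abs_of_pos hρ0]
  set T : (Fin n → ℝ) → (ℕ →ᵇ ℝ) →L[ℝ] (ℕ →ᵇ ℝ) := fun x => (ρ ^ m * c)⁻¹ • G ρ x with hT
  have hTan : AnalyticAt ℝ T 0 :=
    ((analyticAt_const (v := (ρ ^ m * c)⁻¹)).smul (hGan ρ hρr') :)
  set h : (Fin n → ℝ) → (ℕ →ᵇ ℝ) := fun x =>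
    Ring.inverse (1 + (T x - rightShift ^ m) * leftShift ^ m) ((rightShift ^ m) unitSeq) with hh
  have hhan : AnalyticAt ℝ h 0 := by
    have h2 := AnalyticAt.inverse_one_add_sub_mul (A := (ℕ →ᵇ ℝ) →L[ℝ] (ℕ →ᵇ ℝ)) (T := T) (x₀ := 0)
      hTan (shift_division_eq hρ.le).1
    exact ((ContinuousLinearMap.apply ℝ (ℕ →ᵇ ℝ) ((rightShift ^ m) unitSeq)).analyticAt _).comp h2
  have hTnear : ∀ᶠ x in 𝓝 (0 : Fin n → ℝ), ‖T x - rightShift ^ m‖ ≤ 1 / 16 :=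
    (hTan.continuousAt.eventually_norm_sub_lt hρ).mono fun x hx => hx.le
  refine ⟨ρ, hρ0, 2 * |(ρ ^ m * c)⁻¹|, by positivity, fun i x => - h x i, fun i => ⟨?_, ?_⟩, ?_⟩
  · exact (((BoundedContinuousFunction.evalCLM ℝ (i : ℕ)).analyticAt _).comp hhan).neg
  · have h1 := congrArg (BoundedContinuousFunction.evalCLM ℝ (i : ℕ)) (shift_division_eq hρ.le).2
    have h2 : ∀ k ≥ m, ∀ v, BoundedContinuousFunction.evalCLM ℝ (i : ℕ) ((rightShift ^ k) v) = 0 :=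
      fun k hk v => (rightShift_pow_apply k i v).trans (if_pos (i.2.trans_le hk))
    rw [map_add, _root_.sub_apply, map_sub, h2 m le_rfl, h2 m le_rfl, _root_.smul_apply, map_smul,
      hG0 ρ hρr' _ _ (fun k hk => h2 k hk _)] at h1
    rw [smul_zero, sub_zero, add_zero] at h1
    change -h 0 i = 0
    rw [neg_eq_zero]
    exact h1
  filter_upwards [hTnear, Metric.ball_mem_nhds 0 hr0] with x hx hxr τ hτ
  rw [mem_ball_zero_iff] at hxr
  obtain ⟨h1, h2, h3⟩ := shift_division hτ hx (shift_division_eq hx).2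
  have key : τ ^ m + ∑ i : Fin m, -h x i * τ ^ (i : ℕ) = (ρ ^ m * c)⁻¹ *
      (f (Fin.cons (ρ * τ) x) * genFunEval τ hτ ((leftShift ^ m) (h x))) := by
    rw [← hGev ρ x τ hρr' hxr (hτ.trans (by norm_num)) _ (genFunEval_rightShift hτ),
      ← smul_eq_mul, ← map_smul, ← _root_.smul_apply]
    refine Eq.trans ?_ h1
    simp [sub_eq_add_neg, hh]
  change 1 / 2 ≤ genFunEval τ hτ ((leftShift ^ m) (h x)) at h2
  change genFunEval τ hτ ((leftShift ^ m) (h x)) ≤ 2 at h3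
  rw [key]
  constructor
  · rw [abs_mul, abs_mul, abs_of_pos (a := genFunEval τ hτ _) (by linarith)]
    calc _ ≤ |(ρ ^ m * c)⁻¹| * (|f (Fin.cons (ρ * τ) x)| * 2) := by gcongr
      _ = _ := by ring
  · intro h0
    have : genFunEval τ hτ ((leftShift ^ m) (h x)) ≠ 0 := by linarith
    exact (mul_eq_zero.1 ((mul_eq_zero.1 h0).resolve_left (inv_ne_zero hcρ))).resolve_right this

end Weierstrass

section Discriminants

lemma exists_monic_eval_eq_prod {m : ℕ} (a : Fin m → ℂ) :
    ∃ l : Fin m → ℂ, ∀ z : ℂ, z ^ m + ∑ i, a i * z ^ (i : ℕ) = ∏ i, (z - l i) := by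
  set q : Polynomial ℂ := ∑ i, Polynomial.C (a i) * Polynomial.X ^ (i : ℕ)
  have hq : q.degree < m := by
    refine (Polynomial.degree_sum_le _ _).trans_lt ((Finset.sup_lt_iff (WithBot.bot_lt_coe m)).2 ?_)
    intro i _
    exact (Polynomial.degree_C_mul_X_pow_le _ _).trans_lt (WithBot.coe_lt_coe.2 (Nat.cast_lt.2 i.2))
  have hmon := Polynomial.monic_X_pow_add hq
  have hdeg : (Polynomial.X ^ m + q).natDegree = m :=
    Polynomial.natDegree_eq_of_degree_eq_some (by
      rw [Polynomial.degree_add_eq_left_of_degree_lt, Polynomial.degree_X_pow]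
      rwa [Polynomial.degree_X_pow])
  have hs := IsAlgClosed.splits (Polynomial.X ^ m + q)
  have hcard : (Polynomial.X ^ m + q).roots.toList.length = m := by
    rw [Multiset.length_toList, ← hs.natDegree_eq_card_roots, hdeg]
  refine ⟨fun i => (Polynomial.X ^ m + q).roots.toList.get (i.cast hcard.symm), fun z => ?_⟩
  have h1 := congrArg (Polynomial.eval z) (hs.eq_prod_roots_of_monic hmon)
  have h2 : Polynomial.eval z (Polynomial.X ^ m + q) = z ^ m + ∑ i, a i * z ^ (i : ℕ) := by
    simp [q, Polynomial.eval_finsetSum]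
  rw [← h2, h1, Polynomial.eval_multiset_prod, Multiset.map_map]
  generalize (Polynomial.X ^ m + q).roots = s at hcard ⊢
  conv_lhs => rw [← s.coe_toList]
  rw [Multiset.map_coe, Multiset.prod_coe, ← List.prod_ofFn]
  congr 1
  refine List.ext_get (by simp [hcard]) fun i h1 h2 => ?_
  simp

lemma exists_mvPolynomial_eval_coeff {m : ℕ} (Q : MvPolynomial (Fin m) ℝ) (hQ : Q.IsSymmetric) :
    ∃ G : MvPolynomial (Fin m) ℝ, ∀ (a : Fin m → ℝ) (l : Fin m → ℂ),
      (∀ z : ℂ, z ^ m + ∑ i, (a i : ℂ) * z ^ (i : ℕ) = ∏ i, (z - l i)) →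
      ((MvPolynomial.eval a G : ℝ) : ℂ) = MvPolynomial.aeval l Q := by
  obtain ⟨G, hG⟩ := MvPolynomial.esymmAlgHom_surjective (σ := Fin m) (R := ℝ) (n := m) (by simp) ⟨Q, hQ⟩
  refine ⟨MvPolynomial.aeval
    (fun i : Fin m => (-1) ^ (i + 1 : ℕ) * MvPolynomial.X (Fin.rev i)) G, fun a l h => ?_⟩
  have h1 := congrArg Subtype.val hG
  rw [MvPolynomial.esymmAlgHom_apply] at h1
  change _ = Q at h1
  have hp : Polynomial.X ^ m + ∑ i, Polynomial.C (a i : ℂ) * Polynomial.X ^ (i : ℕ)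
      = ((Finset.univ.val.map l).map fun t => Polynomial.X - Polynomial.C t).prod := by
    refine Polynomial.funext fun z => ?_
    rw [Multiset.map_map, Polynomial.eval_multiset_prod, Multiset.map_map]
    have h4 : (Multiset.map (Polynomial.eval z ∘ (fun t => Polynomial.X - Polynomial.C t) ∘ l)
        Finset.univ.val).prod = ∏ i, (z - l i) := by
      simp [Function.comp_def, -Fin.univ_val_map]
    rw [h4, ← h z]
    simp [Polynomial.eval_finsetSum]
  have hcoeff : ∀ i : Fin m, (Finset.univ.val.map l).esymm (i + 1) =
      (-1) ^ (i + 1 : ℕ) * (a (Fin.rev i) : ℂ) := by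
    intro i
    have h2 := congrArg (fun p => Polynomial.coeff p (Fin.rev i : ℕ)) hp
    have hc : (Finset.univ.val.map l).card = m := by simp
    rw [Multiset.prod_X_sub_C_coeff _ (by rw [hc]; exact (Fin.rev i).2.le), hc,
      Polynomial.coeff_add, Polynomial.coeff_X_pow, if_neg (Fin.rev i).2.ne,
      Polynomial.finsetSum_coeff, Finset.sum_eq_single (Fin.rev i)] at h2
    · have h3 : m - (Fin.rev i : ℕ) = i + 1 := by rw [Fin.val_rev]; omega
      rw [h3] at h2
      simp only [Polynomial.coeff_C_mul, Polynomial.coeff_X_pow, if_true, mul_one, zero_add] at h2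
      rw [h2, ← mul_assoc, ← mul_pow]
      simp
    · intro j _ hj
      rw [Polynomial.coeff_C_mul, Polynomial.coeff_X_pow, if_neg (fun h => hj (Fin.ext h.symm)),
        mul_zero]
    · simp
  rw [← h1]
  have key : ((Algebra.ofId ℝ ℂ).comp (MvPolynomial.aeval a)).comp
      (MvPolynomial.aeval fun i : Fin m => (-1) ^ (i + 1 : ℕ) * MvPolynomial.X (Fin.rev i)) =
      (MvPolynomial.aeval l).comp
        (MvPolynomial.aeval fun i : Fin m => MvPolynomial.esymm (Fin m) ℝ (i + 1)) := by
    refine MvPolynomial.algHom_ext fun i => ?_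
    simp [MvPolynomial.aeval_esymm_eq_multiset_esymm, hcoeff, Algebra.ofId_apply,
      -Fin.univ_val_map]
  exact DFunLike.congr_fun key G

end Discriminants

section Differences

open Finset in
/-- The sum over all `j`-tuples of variables of the product of their pairwise differences; it
detects whether `m` numbers take at least `j` distinct values. -/
noncomputable def MvPolynomial.tupleDiscr (m j : ℕ) : MvPolynomial (Fin m) ℝ :=
  ∑ e : Fin j → Fin m, ∏ p ∈ (univ : Finset (Fin j)).offDiag, (X (e p.1) - X (e p.2))

lemma MvPolynomial.isSymmetric_tupleDiscr (m j : ℕ) : (tupleDiscr m j).IsSymmetric := by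
  intro σ
  simp only [tupleDiscr, map_sum, map_prod, map_sub, rename_X]
  exact Fintype.sum_equiv (Equiv.arrowCongr (Equiv.refl _) σ) _ _ fun e => rfl

lemma MvPolynomial.aeval_tupleDiscr {m j : ℕ} (l : Fin m → ℂ) :
    aeval l (tupleDiscr m j) = ∑ e : Fin j → Fin m,
      ∏ p ∈ (Finset.univ : Finset (Fin j)).offDiag, (l (e p.1) - l (e p.2)) := by
  simp [tupleDiscr]

lemma prod_offDiag_sub_eq_zero {j : ℕ} {g : Fin j → ℂ} (hg : ¬ Function.Injective g) :
    ∏ p ∈ (Finset.univ : Finset (Fin j)).offDiag, (g p.1 - g p.2) = 0 := by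
  simp only [Function.Injective, not_forall] at hg
  obtain ⟨a, b, hab, hne⟩ := hg
  exact Finset.prod_eq_zero (i := (a, b)) (by simp [hne]) (by simp [hab])

lemma image_comp_eq_of_injective {m j : ℕ} {l : Fin m → ℂ} (hj : (Finset.univ.image l).card ≤ j)
    {e : Fin j → Fin m} (he : Function.Injective (l ∘ e)) :
    Finset.univ.image (l ∘ e) = Finset.univ.image l := by
  refine Finset.eq_of_subset_of_card_le ?_ ?_
  · intro z
    simp only [Finset.mem_image, Finset.mem_univ, true_and, Function.comp_apply]
    rintro ⟨i, rfl⟩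
    exact ⟨e i, rfl⟩
  · rwa [Finset.card_image_of_injective _ he, Finset.card_univ, Fintype.card_fin]

lemma aeval_tupleDiscr_eq_zero {m j : ℕ} {l : Fin m → ℂ} (hj : (Finset.univ.image l).card < j) :
    MvPolynomial.aeval l (MvPolynomial.tupleDiscr m j) = 0 := by
  rw [MvPolynomial.aeval_tupleDiscr]
  refine Finset.sum_eq_zero fun e _ => prod_offDiag_sub_eq_zero (g := l ∘ e) fun he => hj.ne ?_
  rw [← image_comp_eq_of_injective hj.le he, Finset.card_image_of_injective _ he,
    Finset.card_univ, Fintype.card_fin]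

lemma aeval_tupleDiscr_ne_zero {m j : ℕ} {l : Fin m → ℂ} (hj : (Finset.univ.image l).card = j) :
    MvPolynomial.aeval l (MvPolynomial.tupleDiscr m j) ≠ 0 := by
  classical
  rw [MvPolynomial.aeval_tupleDiscr]
  set D := ∏ q ∈ (Finset.univ.image l).offDiag, (q.1 - q.2) with hD
  have hD0 : D ≠ 0 := Finset.prod_ne_zero_iff.2 fun q hq =>
    sub_ne_zero.2 (Finset.mem_offDiag.1 hq).2.2
  have hterm : ∀ e : Fin j → Fin m,
      ∏ p ∈ (Finset.univ : Finset (Fin j)).offDiag, (l (e p.1) - l (e p.2)) =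
        if Function.Injective (l ∘ e) then D else 0 := by
    intro e
    split_ifs with he
    · rw [hD, ← image_comp_eq_of_injective hj.le he]
      have h1 : (Finset.univ.image (l ∘ e)).offDiag =
          (Finset.univ : Finset (Fin j)).offDiag.image (Prod.map (l ∘ e) (l ∘ e)) := by
        ext ⟨u, v⟩
        simp only [Finset.mem_offDiag, Finset.mem_image, Finset.mem_univ, true_and, Prod.exists,
          Prod.map_apply, Prod.mk.injEq]
        constructor
        · rintro ⟨⟨a, rfl⟩, ⟨b, rfl⟩, h⟩
          exact ⟨a, b, fun hab => h (by rw [hab]), rfl, rfl⟩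
        · rintro ⟨a, b, hab, rfl, rfl⟩
          exact ⟨⟨a, rfl⟩, ⟨b, rfl⟩, fun h => hab (he h)⟩
      rw [h1, Finset.prod_image (he.prodMap he).injOn]
      rfl
    · exact prod_offDiag_sub_eq_zero (g := l ∘ e) he
  simp only [hterm]
  rw [← Finset.sum_filter, Finset.sum_const, nsmul_eq_mul]
  refine mul_ne_zero (Nat.cast_ne_zero.2 (Finset.card_ne_zero.2 ?_)) hD0
  have hmem : ∀ i : Fin j, ∃ k, l k = (((Finset.univ.image l).equivFinOfCardEq hj).symm i : ℂ) := by
    intro i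
    obtain ⟨k, -, hk⟩ := Finset.mem_image.1 (((Finset.univ.image l).equivFinOfCardEq hj).symm i).2
    exact ⟨k, hk⟩
  choose e he using hmem
  refine ⟨e, ?_⟩
  rw [Finset.mem_filter]
  refine ⟨Finset.mem_univ _, fun a b hab => ?_⟩
  simp only [Function.comp_apply, he] at hab
  exact ((Finset.univ.image l).equivFinOfCardEq hj).symm.injective (Subtype.ext hab)

lemma norm_aeval_tupleDiscr_le {m j : ℕ} {l : Fin m → ℂ} (hj : (Finset.univ.image l).card ≤ j)
    {R : ℝ} (hR : 1 ≤ R) (hl : ∀ a b, ‖l a - l b‖ ≤ R) {a b : Fin m} (hab : l a ≠ l b) :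
    ‖MvPolynomial.aeval l (MvPolynomial.tupleDiscr m j)‖ ≤
      (m : ℝ) ^ j * R ^ (j * j) * ‖l a - l b‖ := by
  classical
  rw [MvPolynomial.aeval_tupleDiscr]
  have hterm : ∀ e : Fin j → Fin m,
      ‖∏ p ∈ (Finset.univ : Finset (Fin j)).offDiag, (l (e p.1) - l (e p.2))‖ ≤
        R ^ (j * j) * ‖l a - l b‖ := by
    intro e
    by_cases he : Function.Injective (l ∘ e)
    · have himg := image_comp_eq_of_injective hj he
      have hmem : ∀ i, ∃ k, l (e k) = l i := by
        intro i
        have : l i ∈ Finset.univ.image (l ∘ e) := by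
          rw [himg]
          exact Finset.mem_image_of_mem _ (Finset.mem_univ _)
        simpa using this
      obtain ⟨a', ha⟩ := hmem a
      obtain ⟨b', hb⟩ := hmem b
      have hab' : (a', b') ∈ (Finset.univ : Finset (Fin j)).offDiag := by
        rw [Finset.mem_offDiag]
        refine ⟨Finset.mem_univ _, Finset.mem_univ _, fun h => hab ?_⟩
        rw [← ha, ← hb]
        exact congrArg (fun k => l (e k)) h
      rw [← Finset.mul_prod_erase _ _ hab', norm_mul, ha, hb, mul_comm]
      gcongr
      rw [norm_prod]
      refine (Finset.prod_le_prod (fun _ _ => norm_nonneg _) (fun _ _ => hl _ _)).trans ?_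
      rw [Finset.prod_const]
      refine pow_le_pow_right₀ hR ((Finset.card_erase_le).trans ?_)
      rw [Finset.offDiag_card, Finset.card_univ, Fintype.card_fin]
      omega
    · have h0 := prod_offDiag_sub_eq_zero (g := l ∘ e) he
      simp only [Function.comp_apply] at h0
      rw [h0, norm_zero]
      positivity
  refine (norm_sum_le _ _).trans ((Finset.sum_le_sum fun e _ => hterm e).trans_eq ?_)
  rw [Finset.sum_const, Finset.card_univ, Fintype.card_fun, Fintype.card_fin, Fintype.card_fin,
    nsmul_eq_mul]
  push_cast
  ring

lemma norm_le_of_eval_eq_zero {m : ℕ} {a : Fin m → ℂ} (ha : ∀ i, ‖a i‖ ≤ 1) {z : ℂ}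
    (hz : z ^ m + ∑ i, a i * z ^ (i : ℕ) = 0) : ‖z‖ ≤ m + 1 := by
  by_contra! h
  have h1 : 1 < ‖z‖ := by linarith [(Nat.cast_nonneg m : (0 : ℝ) ≤ m)]
  rcases m with _ | m
  · simp at hz
  have h2 : ‖z‖ ^ (m + 1) ≤ (m + 1 : ℕ) * ‖z‖ ^ m := by
    rw [← norm_pow, eq_neg_of_add_eq_zero_left hz, norm_neg]
    refine (norm_sum_le _ _).trans ?_
    refine (Finset.sum_le_card_nsmul _ _ (‖z‖ ^ m) fun i _ => ?_).trans_eq (by simp)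
    rw [norm_mul, norm_pow]
    calc _ ≤ 1 * ‖z‖ ^ m := by
          gcongr
          · exact ha i
          · exact h1.le
          · omega
      _ = _ := one_mul _
  rw [pow_succ'] at h2
  have h3 := le_of_mul_le_mul_right h2 (by positivity)
  linarith

end Differences

section RootStrata

lemma exists_root_strata {m : ℕ} (hm : 1 ≤ m) :
    ∃ G : ℕ → MvPolynomial (Fin m) ℝ, (∀ j, 2 ≤ j → MvPolynomial.eval 0 (G j) = 0) ∧
      ∃ K : ℕ → ℝ, ∀ a : Fin m → ℝ, (∀ i, |a i| ≤ 1) → ∀ j,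
        (∀ i ∈ Set.Ioc j m, MvPolynomial.eval a (G i) = 0) → ∀ τ : ℝ, ∃ t : ℝ, 0 ≤ t ∧
          t ^ m ≤ |τ ^ m + ∑ i, a i * τ ^ (i : ℕ)| ∧
          ((∃ τ' : ℝ, τ' ^ m + ∑ i, a i * τ' ^ (i : ℕ) = 0 ∧ |τ - τ'| ≤ t) ∨
            2 ≤ j ∧ |MvPolynomial.eval a (G j)| ≤ K j * t) := by
  choose G hG using fun j => exists_mvPolynomial_eval_coeff _
    (MvPolynomial.isSymmetric_tupleDiscr m j)
  have hroots : ∀ a : Fin m → ℝ, ∃ l : Fin m → ℂ, ∀ z : ℂ,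
      z ^ m + ∑ i, (a i : ℂ) * z ^ (i : ℕ) = ∏ i, (z - l i) :=
    fun a => exists_monic_eval_eq_prod _
  refine ⟨G, fun j hj => ?_, fun j => (m : ℝ) ^ j * (2 * (m + 1)) ^ (j * j) * 2,
    fun a ha j hj τ => ?_⟩
  · obtain ⟨l, hl⟩ := hroots 0
    have hl0 : ∀ i, l i = 0 := by
      intro i
      have h1 := hl (l i)
      rw [Finset.prod_eq_zero (Finset.mem_univ i) (sub_self _)] at h1
      have hm0 : m ≠ 0 := by omega
      simpa [hm0] using h1
    have h1 := hG j 0 l hl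
    rw [aeval_tupleDiscr_eq_zero] at h1
    · exact_mod_cast h1
    · refine lt_of_le_of_lt (Finset.card_le_one.2 ?_) (by omega : 1 < j)
      simp [hl0]
  · obtain ⟨l, hl⟩ := hroots a
    have hroot : ∀ i, l i ^ m + ∑ k, (a k : ℂ) * l i ^ (k : ℕ) = 0 := fun i => by
      rw [hl, Finset.prod_eq_zero (Finset.mem_univ i) (sub_self _)]
    have hreal : ∀ s : ℝ, ((s ^ m + ∑ i, a i * s ^ (i : ℕ) : ℝ) : ℂ) = ∏ i, ((s : ℂ) - l i) := by
      intro s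
      rw [← hl]
      push_cast
      rfl
    have hbd : ∀ b c, ‖l b - l c‖ ≤ 2 * (m + 1) := by
      intro b c
      have ha' : ∀ i, ‖(a i : ℂ)‖ ≤ 1 := fun i => by
        rw [Complex.norm_real]
        exact ha i
      linarith [norm_sub_le (l b) (l c), norm_le_of_eval_eq_zero ha' (hroot b),
        norm_le_of_eval_eq_zero ha' (hroot c)]
    have hcard : (Finset.univ.image l).card ≤ j := by
      by_contra! h
      have h1 := hj _ ⟨h, Finset.card_image_le.trans (by simp)⟩
      have h2 := hG (Finset.univ.image l).card a l hl
      rw [h1] at h2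
      exact aeval_tupleDiscr_ne_zero rfl (by rw [← h2, Complex.ofReal_zero])
    have : Nonempty (Fin m) := ⟨⟨0, hm⟩⟩
    obtain ⟨k, -, hk⟩ := Finset.exists_min_image Finset.univ (fun i => ‖(τ : ℂ) - l i‖)
      Finset.univ_nonempty
    refine ⟨‖(τ : ℂ) - l k‖, norm_nonneg _, ?_, ?_⟩
    · rw [← Real.norm_eq_abs, ← Complex.norm_real, hreal, norm_prod]
      calc _ = ∏ _i : Fin m, ‖(τ : ℂ) - l k‖ := by simp
        _ ≤ _ := Finset.prod_le_prod (fun _ _ => norm_nonneg _) hk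
    have him : |(l k).im| ≤ ‖(τ : ℂ) - l k‖ := by
      simpa using Complex.abs_im_le_norm ((τ : ℂ) - l k)
    rcases eq_or_ne (l k).im 0 with h0 | h0
    · left
      have hre : ((l k).re : ℂ) = l k := Complex.ext (by simp) (by simp [h0])
      refine ⟨(l k).re, ?_, ?_⟩
      · have h1 := hreal (l k).re
        rw [hre, Finset.prod_eq_zero (Finset.mem_univ k) (sub_self _)] at h1
        exact_mod_cast h1
      · simpa using Complex.abs_re_le_norm ((τ : ℂ) - l k)
    · right
      obtain ⟨k', hk'⟩ : ∃ k', l k' = (starRingEnd ℂ) (l k) := by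
        have h1 := congrArg (starRingEnd ℂ) (hroot k)
        simp only [map_add, map_pow, map_sum, map_mul, Complex.conj_ofReal, map_zero] at h1
        rw [hl, Finset.prod_eq_zero_iff] at h1
        obtain ⟨k', -, h2⟩ := h1
        exact ⟨k', (sub_eq_zero.1 h2).symm⟩
      have hne : l k ≠ l k' := by
        intro h
        have := congrArg Complex.im (h.trans hk')
        rw [Complex.conj_im] at this
        exact h0 (by linarith)
      constructor
      · refine le_trans (Finset.one_lt_card.2 ⟨l k, ?_, l k', ?_, hne⟩) hcard <;> simp
      · have h1 := norm_aeval_tupleDiscr_le hcard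
          (by linarith [(Nat.cast_nonneg m : (0 : ℝ) ≤ m)]) hbd hne
        rw [← hG j a l hl, Complex.norm_real, Real.norm_eq_abs] at h1
        have h2 : ‖l k - l k'‖ ≤ 2 * ‖(τ : ℂ) - l k‖ := by
          rw [hk', Complex.sub_conj]
          simpa using him
        calc _ ≤ _ := h1
          _ ≤ (m : ℝ) ^ j * (2 * (m + 1)) ^ (j * j) * (2 * ‖(τ : ℂ) - l k‖) := by gcongr
          _ = _ := by ring

end RootStrata

section DistanceBound

variable {E : Type*} [NormedAddCommGroup E]

/-- Near the origin, the distance of a point of `s` to the zero set of `f` is at most a constant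
times a power of the absolute value of `f`. -/
def HasZeroDistBound (f : E → ℝ) (s : Set E) : Prop :=
  ∃ C > 0, ∃ β > 0, β ≤ 1 ∧ ∀ᶠ x in 𝓝 (0 : E), x ∈ s →
    ∃ z, f z = 0 ∧ ‖x - z‖ ≤ C * |f x| ^ (β : ℝ)

lemma HasZeroDistBound.exists_norm_le {f : E → ℝ} {s : Set E} (h : HasZeroDistBound f s)
    (h0 : f 0 = 0) : ∃ C > 0, ∃ β > 0, β ≤ 1 ∧ ∀ᶠ x in 𝓝 (0 : E), x ∈ s →
    ∃ z, f z = 0 ∧ ‖x - z‖ ≤ C * |f x| ^ (β : ℝ) ∧ ‖z‖ ≤ 2 * ‖x‖ := by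
  obtain ⟨C, hC, β, hβ, hβ1, h⟩ := h
  refine ⟨C, hC, β, hβ, hβ1, h.mono fun x hx hxs => ?_⟩
  obtain ⟨z, hz, hxz⟩ := hx hxs
  rcases le_total ‖x - z‖ ‖x‖ with hle | hle
  · exact ⟨z, hz, hxz, by linarith [norm_le_norm_add_norm_sub' z x, norm_sub_rev z x]⟩
  · exact ⟨0, h0, by rw [sub_zero]; exact hle.trans hxz, by simp⟩

set_option maxHeartbeats 1000000 in
lemma hasZeroDistBound_add_sum_mul_pow [NormedSpace ℝ E] [CompleteSpace E] {m : ℕ} (hm : 1 ≤ m)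
    {a : Fin m → E → ℝ} (ha : ∀ i, AnalyticAt ℝ (a i) 0) (ha0 : ∀ i, a i 0 = 0)
    (hE : ∀ g : E → ℝ, AnalyticAt ℝ g 0 → g 0 = 0 → HasZeroDistBound g Set.univ) :
    HasZeroDistBound (fun q : E × ℝ => q.2 ^ m + ∑ i, a i q.1 * q.2 ^ (i : ℕ)) Set.univ := by
  obtain ⟨G, hG0, K, hGK⟩ := exists_root_strata hm
  set P : E × ℝ → ℝ := fun q => q.2 ^ m + ∑ i, a i q.1 * q.2 ^ (i : ℕ) with hP
  have hP0 : P 0 = 0 := by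
    have hm0 : m ≠ 0 := by omega
    simp [hP, ha0, hm0]
  have hPan : AnalyticAt ℝ P 0 := by
    have h1 : ∀ i, AnalyticAt ℝ (fun q : E × ℝ => a i q.1) 0 := fun i =>
      (ha i).comp_of_eq (analyticAt_fst (p := (0 : E × ℝ))) rfl
    refine (analyticAt_snd.pow m).fun_add ?_
    exact Finset.analyticAt_fun_sum _ fun i _ => (h1 i).fun_mul (analyticAt_snd.fun_pow i)
  obtain ⟨L, t, ht, hLip⟩ := (hPan.contDiffAt (n := 1)).exists_lipschitzOnWith
  set S : ℕ → E → ℝ := fun j x => MvPolynomial.eval (fun i => a i x) (G j) with hS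
  have hSan : ∀ j, AnalyticAt ℝ (S j) 0 := fun j =>
    AnalyticAt.aeval_mvPolynomial ha (G j)
  have hS0 : ∀ j, 2 ≤ j → S j 0 = 0 := by
    intro j hj
    simp only [hS, ha0]
    exact hG0 j hj
  have hsmall : ∀ᶠ q in 𝓝 (0 : E × ℝ), |P q| ≤ 1 ∧ ∀ i, |a i q.1| ≤ 1 := by
    refine (hPan.continuousAt.abs.eventually_le_const (by simp [hP0])).and
      (eventually_all.2 fun i => ?_)
    exact (continuousAt_fst.tendsto (x := (0 : E × ℝ))).eventually
      ((ha i).continuousAt.abs.eventually_le_const (by simp [ha0]))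
  have hb : (0 : ℝ) < 1 / m := by positivity
  have hb1 : (1 : ℝ) / m ≤ 1 := by
    rw [div_le_one (by positivity)]
    exact_mod_cast hm
  have hroot : ∀ t ε : ℝ, 0 ≤ t → t ^ m ≤ ε → t ≤ ε ^ (1 / m : ℝ) := by
    intro t ε h1 h2
    rw [one_div, ← Real.pow_rpow_inv_natCast h1 (by omega : m ≠ 0)]
    gcongr
  have hnear : ∀ (q : E × ℝ) (t τ' : ℝ), 0 ≤ t → t ^ m ≤ |P q| → P (q.1, τ') = 0 →
      |q.2 - τ'| ≤ t → ∃ z, P z = 0 ∧ ‖q - z‖ ≤ 1 * |P q| ^ (1 / m : ℝ) := by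
    intro q t τ' ht0 htm h1 h2
    refine ⟨(q.1, τ'), h1, ?_⟩
    rw [one_mul]
    refine le_trans ?_ (h2.trans (hroot t _ ht0 htm))
    simp [Prod.norm_def]
  have hstrata : ∀ j, HasZeroDistBound P {q | ∀ i ∈ Set.Ioc j m, S i q.1 = 0} := by
    intro j
    induction j with
    | zero =>
      refine ⟨1, one_pos, 1 / m, hb, hb1, hsmall.mono fun q hq hqs => ?_⟩
      obtain ⟨t, ht0, htm, ⟨τ', h1, h2⟩ | ⟨h1, -⟩⟩ := hGK _ hq.2 0 hqs q.2
      · exact hnear q t τ' ht0 htm h1 h2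
      · omega
    | succ j ih =>
      set F : E → ℝ := fun x => S (j + 1) x ^ 2 + ∑ i ∈ Finset.Ioc (j + 1) m, S i x ^ 2 with hF
      obtain ⟨C₂, hC₂, β₂, hβ₂, hβ₂1, hIH⟩ := ih
      by_cases hj : 2 ≤ j + 1
      swap
      · refine ⟨1, one_pos, 1 / m, hb, hb1, hsmall.mono fun q hq hqs => ?_⟩
        obtain ⟨t, ht0, htm, ⟨τ', h1, h2⟩ | ⟨h1, -⟩⟩ := hGK _ hq.2 (j + 1) hqs q.2
        · exact hnear q t τ' ht0 htm h1 h2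
        · exact absurd h1 hj
      have hFan : AnalyticAt ℝ F 0 := ((hSan _).fun_pow 2).fun_add
        (Finset.analyticAt_fun_sum _ fun i _ => (hSan i).fun_pow 2)
      have hF0 : F 0 = 0 := by
        simp only [hF, hS0 _ hj]
        rw [Finset.sum_eq_zero fun i hi => ?_]
        · norm_num
        · rw [hS0 i (hj.trans (Finset.mem_Ioc.1 hi).1.le)]
          norm_num
      obtain ⟨C₁, hC₁, β₁, hβ₁, hβ₁1, hE₁⟩ := (hE F hFan hF0).exists_norm_le hF0
      obtain ⟨r, hr, hball⟩ := Metric.eventually_nhds_iff.1 (hIH.and (eventually_mem_set.2 ht))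
      set M : ℝ := |K (j + 1)|
      set A : ℝ := C₁ * (M ^ 2) ^ β₁ with hA
      set B : ℝ := C₂ * (1 + L * A) ^ β₂ with hB
      have hA0 : 0 ≤ A := by positivity
      have hB0 : 0 ≤ B := by positivity
      have hbβ : 1 / m * β₁ ≤ (1 : ℝ) := mul_le_one₀ hb1 hβ₁.le hβ₁1
      refine ⟨1 + A + B, by positivity, 1 / m * β₁ * β₂, by positivity,
        mul_le_one₀ hbβ hβ₂.le hβ₂1, ?_⟩
      filter_upwards [hsmall, (continuousAt_fst.tendsto (x := (0 : E × ℝ))).eventually hE₁,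
        Metric.ball_mem_nhds (0 : E × ℝ) (half_pos hr)] with q hq hqE hqr hqs
      rw [mem_ball_zero_iff] at hqr
      set ε := |P q|
      have hε0 : 0 ≤ ε := abs_nonneg _
      have hmono : ∀ u v : ℝ, 0 < u → u ≤ v → ε ^ v ≤ ε ^ u := fun u v hu huv =>
        Real.rpow_le_rpow_of_exponent_ge_of_imp hε0 hq.1 huv (fun _ h => absurd h (hu.trans_le huv).ne')
      obtain ⟨t, ht0, htm, ⟨τ', h1, h2⟩ | ⟨-, h2⟩⟩ := hGK _ hq.2 (j + 1) hqs q.2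
      · obtain ⟨z, hz, hqz⟩ := hnear q t τ' ht0 htm h1 h2
        refine ⟨z, hz, hqz.trans ?_⟩
        gcongr ?_ * ?_
        · linarith
        · refine hmono _ _ (by positivity) ?_
          rw [mul_assoc]
          exact mul_le_of_le_one_right hb.le (mul_le_one₀ hβ₁1 hβ₂.le hβ₂1)
      have htε : t ≤ ε ^ (1 / m : ℝ) := hroot t _ ht0 htm
      have hε1 : ε ^ (1 / m : ℝ) ≤ 1 := Real.rpow_le_one hε0 hq.1 hb.le
      have hFx : |F q.1| ≤ M ^ 2 * ε ^ (1 / m : ℝ) := by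
        have h3 : F q.1 = S (j + 1) q.1 ^ 2 := by
          simp only [hF]
          rw [Finset.sum_eq_zero, add_zero]
          intro i hi
          rw [hqs i (Finset.mem_Ioc.1 hi), zero_pow two_ne_zero]
        have h4 : |S (j + 1) q.1| ≤ M * t :=
          h2.trans (mul_le_mul_of_nonneg_right (le_abs_self _) ht0)
        rw [h3, abs_pow]
        calc _ ≤ (M * t) ^ 2 := by gcongr
          _ = M ^ 2 * (t * t) := by ring
          _ ≤ M ^ 2 * (ε ^ (1 / m : ℝ) * 1) := by gcongr; exact htε.trans hε1
          _ = _ := by rw [mul_one]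
      obtain ⟨x', hFx', hxx', hx'⟩ := hqE (Set.mem_univ _)
      have hdist : ‖q.1 - x'‖ ≤ A * ε ^ (1 / m * β₁ : ℝ) := by
        refine hxx'.trans ?_
        calc _ ≤ C₁ * (M ^ 2 * ε ^ (1 / m : ℝ)) ^ β₁ := by gcongr
          _ = _ := by
            rw [Real.mul_rpow (by positivity) (by positivity), ← Real.rpow_mul hε0, hA]
            ring
      have hS' : ∀ i ∈ Set.Ioc j m, S i x' = 0 := by
        have h3 : 0 ≤ ∑ i ∈ Finset.Ioc (j + 1) m, S i x' ^ 2 :=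
          Finset.sum_nonneg fun i _ => sq_nonneg _
        have h4 : S (j + 1) x' ^ 2 = 0 ∧ ∑ i ∈ Finset.Ioc (j + 1) m, S i x' ^ 2 = 0 := by
          simp only [hF] at hFx'
          constructor <;> nlinarith [sq_nonneg (S (j + 1) x')]
        rw [Finset.sum_eq_zero_iff_of_nonneg fun i _ => sq_nonneg _] at h4
        intro i hi
        rcases eq_or_lt_of_le (Nat.succ_le_of_lt hi.1) with rfl | hlt
        · exact pow_eq_zero_iff two_ne_zero |>.1 h4.1
        · exact pow_eq_zero_iff two_ne_zero |>.1 (h4.2 i (Finset.mem_Ioc.2 ⟨hlt, hi.2⟩))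
      have hqmem : dist q 0 < r := by
        rw [dist_zero_right]
        linarith
      have hnorm : ‖(x', q.2)‖ ≤ 2 * ‖q‖ := by
        rw [norm_prod_le_iff]
        exact ⟨hx'.trans (by linarith [norm_fst_le q]),
          by linarith [norm_snd_le q, norm_nonneg q.2]⟩
      have hq'mem : dist (x', q.2) (0 : E × ℝ) < r := by
        rw [dist_zero_right]
        linarith
      obtain ⟨z, hz, hqz⟩ := (hball hq'mem).1 hS'
      have hP' : |P (x', q.2)| ≤ (1 + L * A) * ε ^ (1 / m * β₁ : ℝ) := by
        have h3 := hLip.dist_le_mul _ (hball hq'mem).2 _ (hball hqmem).2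
        have h4 : dist (x', q.2) q = ‖q.1 - x'‖ := by
          rw [dist_comm, dist_eq_norm]
          simp [Prod.norm_def]
        rw [h4, Real.dist_eq] at h3
        have h5 : ε ≤ ε ^ (1 / m * β₁ : ℝ) := by
          simpa using hmono (1 / m * β₁) 1 (by positivity) hbβ
        have h6 : (L : ℝ) * ‖q.1 - x'‖ ≤ L * (A * ε ^ (1 / m * β₁ : ℝ)) := by gcongr
        have h7 := abs_sub_abs_le_abs_sub (P (x', q.2)) (P q)
        change _ - ε ≤ _ at h7
        linarith
      refine ⟨z, hz, ?_⟩
      have hfirst : ‖q - (x', q.2)‖ ≤ A * ε ^ (1 / m * β₁ * β₂ : ℝ) := by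
        have h3 : ‖q - (x', q.2)‖ = ‖q.1 - x'‖ := by simp [Prod.norm_def]
        rw [h3]
        refine hdist.trans (mul_le_mul_of_nonneg_left ?_ hA0)
        exact hmono _ _ (by positivity) (mul_le_of_le_one_right (by positivity) hβ₂1)
      have hsecond : ‖(x', q.2) - z‖ ≤ B * ε ^ (1 / m * β₁ * β₂ : ℝ) := by
        refine hqz.trans ?_
        calc _ ≤ C₂ * ((1 + L * A) * ε ^ (1 / m * β₁ : ℝ)) ^ β₂ := by gcongr
          _ = _ := by
            rw [Real.mul_rpow (by positivity) (by positivity), ← Real.rpow_mul hε0, hB]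
            ring
      have hpos : 0 ≤ ε ^ (1 / m * β₁ * β₂ : ℝ) := by positivity
      calc ‖q - z‖ ≤ ‖q - (x', q.2)‖ + ‖(x', q.2) - z‖ := norm_sub_le_norm_sub_add_norm_sub _ _ _
        _ ≤ _ := by linarith
  obtain ⟨C, hC, β, hβ, hβ1, h⟩ := hstrata m
  exact ⟨C, hC, β, hβ, hβ1, h.mono fun q hq _ => hq fun i hi => absurd hi.1 (not_lt.2 hi.2)⟩

end DistanceBound

section AnalyticDistanceBound

lemma HasZeroDistBound.of_comp_equiv {E F : Type*} [NormedAddCommGroup E] [NormedSpace ℝ E]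
    [NormedAddCommGroup F] [NormedSpace ℝ F] (T : E ≃L[ℝ] F) {f : F → ℝ}
    (h : HasZeroDistBound (f ∘ T) Set.univ) : HasZeroDistBound f Set.univ := by
  obtain ⟨C, hC, β, hβ, hβ1, h⟩ := h
  refine ⟨(‖(T : E →L[ℝ] F)‖ + 1) * C, by positivity, β, hβ, hβ1, ?_⟩
  have ht : Tendsto T.symm (𝓝 0) (𝓝 0) := by simpa using T.symm.continuous.tendsto 0
  filter_upwards [ht.eventually h] with x hx _
  obtain ⟨z, hz, hxz⟩ := hx (Set.mem_univ _)
  refine ⟨T z, hz, ?_⟩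
  have h1 : x - T z = (T : E →L[ℝ] F) (T.symm x - z) := by simp
  rw [Function.comp_apply, T.apply_symm_apply] at hxz
  rw [h1, mul_assoc]
  refine ((T : E →L[ℝ] F).le_opNorm _).trans ?_
  gcongr
  linarith

lemma hasZeroDistBound_of_order {n m : ℕ} (hm : 1 ≤ m) {f : (Fin (n + 1) → ℝ) → ℝ}
    {p : FormalMultilinearSeries ℝ (Fin (n + 1) → ℝ) ℝ} (hf : HasFPowerSeriesAt f p 0)
    (hlt : ∀ k < m, p k (fun _ => Pi.single 0 1) = 0) (hpm : p m (fun _ => Pi.single 0 1) ≠ 0)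
    (hn : ∀ g : (Fin n → ℝ) → ℝ, AnalyticAt ℝ g 0 → g 0 = 0 → HasZeroDistBound g Set.univ) :
    HasZeroDistBound f Set.univ := by
  obtain ⟨ρ, hρ, C, hC, a, ha, hW⟩ := exists_weierstrass_polynomial hf hlt hpm
  have h1 := hasZeroDistBound_add_sum_mul_pow hm (fun i => (ha i).1) (fun i => (ha i).2) hn
  have hm0 : m ≠ 0 := by omega
  obtain ⟨C', hC', β, hβ, hβ1, h2⟩ := h1.exists_norm_le (by simp [ha, hm0])
  obtain ⟨r, hr, hball⟩ := Metric.eventually_nhds_iff_ball.1 hW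
  refine ⟨(1 + ρ) * (C' * C ^ β), by positivity, β, hβ, hβ1, ?_⟩
  have ht : Tendsto (fun w : Fin (n + 1) → ℝ => (Fin.tail w, ρ⁻¹ * w 0)) (𝓝 0) (𝓝 0) := by
    have hc : Continuous (fun w : Fin (n + 1) → ℝ => (Fin.tail w, ρ⁻¹ * w 0)) := by
      unfold Fin.tail
      fun_prop
    have := hc.tendsto 0
    have h0 : ((Fin.tail (0 : Fin (n + 1) → ℝ), ρ⁻¹ * (0 : Fin (n + 1) → ℝ) 0) :
        (Fin n → ℝ) × ℝ) = 0 := by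
      ext <;> simp [Fin.tail]
    rwa [h0] at this
  have hs : 0 < min (r / 2) (1 / 4) := by positivity
  filter_upwards [ht.eventually h2, ht.eventually (Metric.ball_mem_nhds _ hs)] with w hw hwb _
  obtain ⟨⟨x', τ'⟩, hz, hqz, hz2⟩ := hw (Set.mem_univ _)
  rw [dist_zero_right, lt_min_iff] at hwb
  set q : (Fin n → ℝ) × ℝ := (Fin.tail w, ρ⁻¹ * w 0) with hq
  have hwq : Fin.cons (ρ * q.2) q.1 = w := by
    rw [hq]
    simp only [mul_inv_cancel_left₀ hρ.ne', Fin.cons_self_tail]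
  have hq1 : q.1 ∈ Metric.ball 0 r := by
    rw [mem_ball_zero_iff]
    linarith [norm_fst_le q]
  have hx' : x' ∈ Metric.ball 0 r := by
    rw [mem_ball_zero_iff]
    linarith [norm_fst_le (x', τ')]
  have hq2 : |q.2| ≤ 1 / 2 := by
    have := norm_snd_le q
    rw [Real.norm_eq_abs] at this
    linarith
  have hτ' : |τ'| ≤ 1 / 2 := by
    have := norm_snd_le (x', τ')
    rw [Real.norm_eq_abs] at this
    linarith
  refine ⟨Fin.cons (ρ * τ') x', (hball _ hx' _ hτ').2 hz, ?_⟩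
  have h3 := (hball _ hq1 _ hq2).1
  rw [hwq] at h3
  have h4 : ‖w - Fin.cons (ρ * τ') x'‖ ≤ (1 + ρ) * ‖q - (x', τ')‖ := by
    rw [← hwq, pi_norm_le_iff_of_nonneg (by positivity)]
    intro i
    refine Fin.cases ?_ (fun i => ?_) i
    · have := norm_snd_le (q - (x', τ'))
      simp only [Pi.sub_apply, Fin.cons_zero]
      rw [← mul_sub, norm_mul, Real.norm_of_nonneg hρ.le]
      gcongr
      · linarith
      · exact this
    · simp only [Pi.sub_apply, Fin.cons_succ]
      have h5 : ‖q.1 i - x' i‖ ≤ ‖q.1 - x'‖ := norm_le_pi_norm (q.1 - x') i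
      have h6 := norm_fst_le (q - (x', τ'))
      change ‖q.1 - x'‖ ≤ _ at h6
      nlinarith [norm_nonneg (q - (x', τ'))]
  refine h4.trans ?_
  rw [mul_assoc]
  gcongr
  refine hqz.trans ?_
  rw [mul_assoc, ← Real.mul_rpow hC.le (abs_nonneg _)]
  gcongr

lemma hasZeroDistBound_of_eventually_eq_zero {E : Type*} [NormedAddCommGroup E] {f : E → ℝ}
    (h : ∀ᶠ x in 𝓝 0, f x = 0) : HasZeroDistBound f Set.univ :=
  ⟨1, one_pos, 1, one_pos, le_rfl, h.mono fun x hx _ => ⟨x, hx, by simp⟩⟩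

theorem hasZeroDistBound_of_analyticAt {n : ℕ} {f : (Fin n → ℝ) → ℝ} (hf : AnalyticAt ℝ f 0)
    (hf0 : f 0 = 0) : HasZeroDistBound f Set.univ := by
  induction n with
  | zero =>
    refine hasZeroDistBound_of_eventually_eq_zero (Eventually.of_forall fun x => ?_)
    rw [Subsingleton.elim x 0, hf0]
  | succ n ih =>
    obtain ⟨p, hp⟩ := hf
    by_cases hall : ∀ y k, p k (fun _ => y) = 0
    · refine hasZeroDistBound_of_eventually_eq_zero (hp.eventually_hasSum.mono fun y hy => ?_)
      rw [zero_add] at hy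
      exact hy.unique (hasSum_zero.congr_fun fun k => hall y k)
    push Not at hall
    obtain ⟨y, hk⟩ := hall
    classical
    set m := Nat.find hk with hm
    have hm1 : 1 ≤ m := by
      rw [hm, Nat.one_le_iff_ne_zero, Ne, Nat.find_eq_zero, not_not, hp.coeff_zero, hf0]
    have hpm : p m (fun _ => y) ≠ 0 := Nat.find_spec hk
    have hy : y ≠ 0 := by
      rintro rfl
      have : Nonempty (Fin m) := ⟨⟨0, hm1⟩⟩
      exact hpm (p m).map_zero
    obtain ⟨T, hT⟩ := SeparatingDual.exists_continuousLinearEquiv_apply_eq (R := ℝ)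
      (x := (Pi.single 0 1 : Fin (n + 1) → ℝ)) (y := y) (by simp) hy
    refine HasZeroDistBound.of_comp_equiv T ?_
    have hpT : HasFPowerSeriesAt (f ∘ T)
        (p.compContinuousLinearMap (T : (Fin (n + 1) → ℝ) →L[ℝ] (Fin (n + 1) → ℝ))) 0 :=
      HasFPowerSeriesAt.compContinuousLinearMap
        (u := (T : (Fin (n + 1) → ℝ) →L[ℝ] (Fin (n + 1) → ℝ))) (by simpa using hp)
    have happ : ∀ k, p.compContinuousLinearMap (T : (Fin (n + 1) → ℝ) →L[ℝ] (Fin (n + 1) → ℝ)) k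
        (fun _ => Pi.single 0 1) = p k (fun _ => y) := by
      intro k
      rw [FormalMultilinearSeries.compContinuousLinearMap_apply]
      congr 1
      funext i
      exact hT
    refine hasZeroDistBound_of_order hm1 hpT (fun k hk' => ?_) ?_ fun g hg hg0 => ih hg hg0
    · rw [happ]
      exact not_not.1 (Nat.find_min hk hk')
    · rwa [happ]

end AnalyticDistanceBound

end LojasiewiczDistance

/-- **Łojasiewicz gradient–distance inequality for an analytic function.** Let `E : U → ℝ`
be real analytic on a neighborhood of `x∞` in `ℝ^d` with `E'(x∞) = 0`. Then there are
`C₃ ∈ (0,∞)`, `σ₁ ∈ (0,1]` with `B_{σ₁}(x∞) ⊆ U`, `δ₁ ∈ (0,σ₁/4]`, and `γ ∈ [1/2,∞)` such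
that `‖E'(x)‖ ≥ C₃ · dist(x, B_{σ₁}(x∞) ∩ Crit E)^γ` for all `x ∈ B_{δ₁}(x∞)`. -/
theorem lojasiewicz_gradient_distance_inequality_analytic
    (d : ℕ) (hd : 1 ≤ d)
    (U : Set (EuclideanSpace ℝ (Fin d))) (hU : IsOpen U)
    (x_inf : EuclideanSpace ℝ (Fin d)) (hx : x_inf ∈ U)
    (E : EuclideanSpace ℝ (Fin d) → ℝ) (hE : AnalyticOnNhd ℝ E U)
    (hcrit : fderiv ℝ E x_inf = 0) :
    ∃ C₃ : ℝ, 0 < C₃ ∧ ∃ σ₁ ∈ Set.Ioc (0:ℝ) 1, Metric.ball x_inf σ₁ ⊆ U ∧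
      ∃ δ₁ ∈ Set.Ioc (0:ℝ) (σ₁/4), ∃ γ : ℝ, 1/2 ≤ γ ∧
        ∀ x ∈ Metric.ball x_inf δ₁,
          ‖fderiv ℝ E x‖ ≥ C₃ * (Metric.infDist x
            (Metric.ball x_inf σ₁ ∩ {y ∈ U | fderiv ℝ E y = 0})) ^ γ := by
  set D : EuclideanSpace ℝ (Fin d) → (EuclideanSpace ℝ (Fin d) →L[ℝ] ℝ) :=
    fun y => fderiv ℝ E (x_inf + y) with hD
  set e : Fin d → EuclideanSpace ℝ (Fin d) := fun i => EuclideanSpace.basisFun (Fin d) ℝ i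
  set g : EuclideanSpace ℝ (Fin d) → ℝ := fun y => ∑ i, D y (e i) ^ 2 with hg
  have hDan : AnalyticAt ℝ D 0 :=
    (hE.fderiv x_inf hx).comp_of_eq (analyticAt_const.fun_add analyticAt_id) (by simp)
  have hgan : AnalyticAt ℝ g 0 := Finset.analyticAt_fun_sum _ fun i _ =>
    (((ContinuousLinearMap.apply ℝ ℝ (e i)).analyticAt _).comp hDan).fun_pow 2
  have hg0 : g 0 = 0 := by simp [hg, hD, hcrit]
  have hgD : ∀ y, g y = 0 → D y = 0 := by
    intro y hy
    rw [hg, Finset.sum_eq_zero_iff_of_nonneg fun i _ => sq_nonneg _] at hy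
    refine ContinuousLinearMap.coe_injective ((EuclideanSpace.basisFun (Fin d) ℝ).toBasis.ext fun i => ?_)
    simpa [e] using hy i (Finset.mem_univ i)
  have hgle : ∀ y, |g y| ≤ d * ‖D y‖ ^ 2 := by
    intro y
    rw [abs_of_nonneg (Finset.sum_nonneg fun i _ => sq_nonneg _)]
    refine (Finset.sum_le_card_nsmul _ _ (‖D y‖ ^ 2) fun i _ => ?_).trans_eq (by simp)
    rw [← sq_abs]
    gcongr
    simpa [e] using (D y).le_opNorm (e i)
  obtain ⟨C, hC, β, hβ, hβ1, hdist⟩ : HasZeroDistBound g Set.univ := by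
    refine HasZeroDistBound.of_comp_equiv (EuclideanSpace.equiv (Fin d) ℝ).symm
      (hasZeroDistBound_of_analyticAt ?_ (by simpa using hg0))
    exact hgan.comp_of_eq ((EuclideanSpace.equiv (Fin d) ℝ).symm.analyticAt 0) (map_zero _)
  obtain ⟨r, hr, hball⟩ := Metric.eventually_nhds_iff_ball.1 hdist
  obtain ⟨σ, hσ, hσU⟩ := Metric.isOpen_iff.1 hU x_inf hx
  set s := min σ 1 with hs
  have hs0 : 0 < s := lt_min hσ one_pos
  have hsU : Metric.ball x_inf s ⊆ U :=
    (Metric.ball_subset_ball (min_le_left _ _)).trans hσU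
  have hd0 : (0 : ℝ) < d := by exact_mod_cast hd
  set M : ℝ := C * (d : ℝ) ^ β with hM
  have hM0 : 0 < M := by positivity
  refine ⟨(M ^ (1 / (2 * β)))⁻¹, by positivity, s, ⟨hs0, min_le_right _ _⟩, hsU,
    min (s / 4) r, ⟨by positivity, min_le_left _ _⟩, 1 / (2 * β), ?_, fun x hxb => ?_⟩
  · exact one_div_le_one_div_of_le (by positivity) (by linarith)
  rw [mem_ball_iff_norm, lt_min_iff] at hxb
  obtain ⟨z, hz, hxz⟩ := hball (x - x_inf) (by simpa using hxb.2) (Set.mem_univ _)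
  have hDx : D (x - x_inf) = fderiv ℝ E x := by simp [hD]
  have hle : Metric.infDist x (Metric.ball x_inf s ∩ {y ∈ U | fderiv ℝ E y = 0}) ≤
      ‖x - x_inf - z‖ := by
    rcases lt_or_ge ‖z‖ s with hzs | hzs
    · have hmem : x_inf + z ∈ Metric.ball x_inf s := by simpa using hzs
      have hcz : x_inf + z ∈ Metric.ball x_inf s ∩ {y ∈ U | fderiv ℝ E y = 0} :=
        ⟨hmem, hsU hmem, hgD z hz⟩
      refine (Metric.infDist_le_dist_of_mem hcz).trans_eq ?_
      rw [dist_eq_norm, sub_sub]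
    · have hcx : x_inf ∈ Metric.ball x_inf s ∩ {y ∈ U | fderiv ℝ E y = 0} :=
        ⟨Metric.mem_ball_self hs0, hx, hcrit⟩
      refine (Metric.infDist_le_dist_of_mem hcx).trans ?_
      rw [dist_eq_norm]
      linarith [norm_le_norm_add_norm_sub (x - x_inf) z]
  have hbound : ‖x - x_inf - z‖ ≤ M * ‖fderiv ℝ E x‖ ^ (2 * β) := by
    refine hxz.trans ?_
    rw [hM, mul_assoc, ← hDx]
    gcongr
    calc _ ≤ (d * ‖D (x - x_inf)‖ ^ 2) ^ β := by gcongr; exact hgle _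
      _ = _ := by
        rw [Real.mul_rpow hd0.le (by positivity), ← Real.rpow_natCast, ← Real.rpow_mul (by positivity)]
        norm_num
  rw [ge_iff_le, inv_mul_le_iff₀ (by positivity)]
  calc _ ≤ (M * ‖fderiv ℝ E x‖ ^ (2 * β)) ^ (1 / (2 * β)) := by
        gcongr
        · exact Metric.infDist_nonneg
        · exact hle.trans hbound
    _ = _ := by
      rw [Real.mul_rpow hM0.le (by positivity), ← Real.rpow_mul (norm_nonneg _),
        mul_one_div_cancel (by positivity), Real.rpow_one]
end

section
/- Let d ≥ 1 be an integer, 𝕂 = ℝ or ℂ, U ⊆ 𝕂^d an open subset, E : U → 𝕂 a C² function, and x∞ ∈ Crit E. Suppose E is Morse–Bott at x∞ with flat critical locus: there is a 𝕂-linear subspace K ⊆ 𝕂^d such that Crit E ∩ U = (x∞ + K) ∩ U and K equals the kernel of the Hessian E''(x∞), viewed as a linear operator 𝕂^d → (𝕂^d)^*. Then there exist constants C₀ ∈ (0,∞) and σ₀ ∈ (0,1] with B_{σ₀}(x∞) ⊆ U such that ‖E'(x)‖ ≥ C₀ · |E(x) − E(x∞)|^{1/2} for all x ∈ B_{σ₀}(x∞).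 -/
/-- A continuous linear map is bounded below on the orthogonal complement of its kernel. -/
theorem ContinuousLinearMap.exists_mul_norm_le_of_mem_orthogonal_ker
    {𝕜 V W : Type*} [RCLike 𝕜] [NormedAddCommGroup V] [InnerProductSpace 𝕜 V]
    [FiniteDimensional 𝕜 V] [NormedAddCommGroup W] [NormedSpace 𝕜 W]
    (H : V →L[𝕜] W) (K : Submodule 𝕜 V) (hK : ∀ v, H v = 0 → v ∈ K) :
    ∃ c : ℝ, 0 < c ∧ ∀ w ∈ Kᗮ, c * ‖w‖ ≤ ‖H w‖ := by
  have hbot : LinearMap.ker ((H : V →ₗ[𝕜] W) ∘ₗ Kᗮ.subtype) = ⊥ := by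
    rw [LinearMap.ker_eq_bot']
    rintro ⟨w, hw⟩ h
    have hwK : w ∈ K ⊓ Kᗮ := ⟨hK w h, hw⟩
    rw [K.inf_orthogonal_eq_bot, Submodule.mem_bot] at hwK
    exact Subtype.ext hwK
  obtain ⟨A, hA, hanti⟩ := LinearMap.exists_antilipschitzWith _ hbot
  have hA' : (0 : ℝ) < A := hA
  refine ⟨(A : ℝ)⁻¹, inv_pos.2 hA', fun w hw ↦ ?_⟩
  have h := hanti.le_mul_dist ⟨w, hw⟩ 0
  simp only [map_zero, dist_zero_right] at h
  rw [inv_mul_le_iff₀ hA']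
  exact h


/-- **Łojasiewicz gradient inequality for a Morse–Bott function (flat critical locus).**
Let `E : U → 𝕜` be `C²` on an open set `U ⊆ 𝕜^d` and `x∞ ∈ Crit E`. Suppose there is a
`𝕜`-linear subspace `K ⊆ 𝕜^d` with `Crit E ∩ U = (x∞ + K) ∩ U` and `K` equal to the kernel
of the Hessian `E''(x∞) : 𝕜^d → (𝕜^d)^*`. Then there are `C₀ ∈ (0,∞)` and `σ₀ ∈ (0,1]`
with `B_{σ₀}(x∞) ⊆ U` such that `‖E'(x)‖ ≥ C₀ · |E(x) − E(x∞)|^{1/2}` on `B_{σ₀}(x∞)`. -/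
theorem lojasiewicz_gradient_inequality_morse_bott
    (d : ℕ) (hd : 1 ≤ d) (𝕜 : Type) [RCLike 𝕜]
    (U : Set (EuclideanSpace 𝕜 (Fin d))) (hU : IsOpen U)
    (E : EuclideanSpace 𝕜 (Fin d) → 𝕜) (hE : ContDiffOn 𝕜 2 E U)
    (x_inf : EuclideanSpace 𝕜 (Fin d)) (hx : x_inf ∈ U)
    (hcrit : fderiv 𝕜 E x_inf = 0)
    (K : Submodule 𝕜 (EuclideanSpace 𝕜 (Fin d)))
    (hcritloc : {x ∈ U | fderiv 𝕜 E x = 0}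
      = {x : EuclideanSpace 𝕜 (Fin d) | x - x_inf ∈ K} ∩ U)
    (hker : (K : Set (EuclideanSpace 𝕜 (Fin d)))
      = {v : EuclideanSpace 𝕜 (Fin d) | fderiv 𝕜 (fderiv 𝕜 E) x_inf v = 0}) :
    ∃ C₀ : ℝ, 0 < C₀ ∧ ∃ σ₀ ∈ Set.Ioc (0:ℝ) 1, Metric.ball x_inf σ₀ ⊆ U ∧
      ∀ x ∈ Metric.ball x_inf σ₀,
        ‖fderiv 𝕜 E x‖ ≥ C₀ * ‖E x - E x_inf‖ ^ (1/2 : ℝ) := by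
  have hEx : ContDiffAt 𝕜 2 E x_inf := hE.contDiffAt (hU.mem_nhds hx)
  have hstrict : HasStrictFDerivAt (fderiv 𝕜 E) (fderiv 𝕜 (fderiv 𝕜 E) x_inf) x_inf :=
    (hEx.fderiv_right (m := 1) (by norm_num)).hasStrictFDerivAt one_ne_zero
  set H := fderiv 𝕜 (fderiv 𝕜 E) x_inf
  obtain ⟨c, hc, hlow⟩ := H.exists_mul_norm_le_of_mem_orthogonal_ker K
    fun v hv ↦ by rw [← SetLike.mem_coe, hker]; exact hv
  have happ : ∀ᶠ p : EuclideanSpace 𝕜 (Fin d) × EuclideanSpace 𝕜 (Fin d) in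
      nhds (x_inf, x_inf), ‖fderiv 𝕜 E p.1 - fderiv 𝕜 E p.2 - H (p.1 - p.2)‖
        ≤ c / 2 * ‖p.1 - p.2‖ := hstrict.isLittleO.def (half_pos hc)
  obtain ⟨r, hr, happ⟩ := Metric.eventually_nhds_iff_ball.1 happ
  obtain ⟨s, hs, hsU⟩ := Metric.isOpen_iff.1 hU x_inf hx
  set σ := min (min r s) 1
  have hσ : 0 < σ := lt_min (lt_min hr hs) one_pos
  have hσU : Metric.ball x_inf σ ⊆ U :=
    (Metric.ball_subset_ball ((min_le_left _ _).trans (min_le_right _ _))).trans hsU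
  have happ' : ∀ x ∈ Metric.ball x_inf σ, ∀ y ∈ Metric.ball x_inf σ,
      ‖fderiv 𝕜 E x - fderiv 𝕜 E y - H (x - y)‖ ≤ c / 2 * ‖x - y‖ := by
    have hσr : Metric.ball x_inf σ ⊆ Metric.ball x_inf r :=
      Metric.ball_subset_ball ((min_le_left _ _).trans (min_le_left _ _))
    intro x hx y hy
    refine happ (x, y) ?_
    rw [← ball_prod_same]
    exact ⟨hσr hx, hσr hy⟩
  have hdiff : ∀ x ∈ Metric.ball x_inf σ, DifferentiableAt 𝕜 E x := fun x hx ↦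
    (hE.contDiffAt (hU.mem_nhds (hσU hx))).differentiableAt two_ne_zero
  have hconv : Convex ℝ (Metric.ball x_inf σ) := convex_ball _ _
  have hzero : ∀ y ∈ Metric.ball x_inf σ, y - x_inf ∈ K → fderiv 𝕜 E y = 0 := by
    intro y hy hyK
    have : y ∈ {x ∈ U | fderiv 𝕜 E x = 0} := by rw [hcritloc]; exact ⟨hyK, hσU hy⟩
    exact this.2
  have hx_inf : x_inf ∈ Metric.ball x_inf σ := Metric.mem_ball_self hσ
  set L := ‖H‖ + c / 2
  have hL : 0 < L := by positivity
  refine ⟨c / 2 / √L, by positivity, σ, ⟨hσ, min_le_right _ _⟩, hσU, fun x hx ↦ ?_⟩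
  set y := x_inf + K.starProjection (x - x_inf) with hy_def
  have hyK : y - x_inf ∈ K := by
    rw [hy_def, add_sub_cancel_left]
    exact K.starProjection_apply_mem _
  have hy : y ∈ Metric.ball x_inf σ := by
    rw [mem_ball_iff_norm] at hx ⊢
    refine lt_of_le_of_lt ?_ hx
    rw [hy_def, add_sub_cancel_left]
    exact K.norm_starProjection_apply_le (x - x_inf)
  have hperp : x - y ∈ Kᗮ := by
    have := K.sub_starProjection_mem_orthogonal (x - x_inf)
    rwa [sub_sub] at this
  have hFy := hzero y hy hyK
  have hgrad : c / 2 * ‖x - y‖ ≤ ‖fderiv 𝕜 E x‖ := by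
    have h1 := happ' x hx y hy
    rw [hFy, sub_zero, norm_sub_rev] at h1
    have h2 := norm_sub_norm_le (H (x - y)) (fderiv 𝕜 E x)
    have h3 := hlow _ hperp
    linarith
  have hEy : E y = E x_inf := by
    have hbound : ∀ z ∈ segment ℝ x_inf y, ‖fderiv 𝕜 E z‖ ≤ 0 := by
      intro z hz
      rw [hzero z (hconv.segment_subset hx_inf hy hz), norm_zero]
      obtain ⟨t, -, rfl⟩ := (segment_eq_image' ℝ x_inf y ▸ hz :)
      rw [add_sub_cancel_left, RCLike.real_smul_eq_coe_smul (K := 𝕜)]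
      exact K.smul_mem _ hyK
    have h := (convex_segment x_inf y).norm_image_sub_le_of_norm_fderiv_le
      (fun z hz ↦ hdiff z (hconv.segment_subset hx_inf hy hz)) hbound
      (left_mem_segment ℝ x_inf y) (right_mem_segment ℝ x_inf y)
    rw [zero_mul] at h
    exact sub_eq_zero.1 (norm_le_zero_iff.1 h)
  have hquad : ‖E x - E x_inf‖ ≤ L * ‖x - y‖ ^ 2 := by
    have hbound : ∀ z ∈ segment ℝ y x, ‖fderiv 𝕜 E z‖ ≤ L * ‖x - y‖ := by
      intro z hz
      have h1 := happ' z (hconv.segment_subset hy hx hz) y hy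
      rw [hFy, sub_zero] at h1
      have h2 := norm_sub_norm_le (fderiv 𝕜 E z) (H (z - y))
      have h3 := H.le_opNorm (z - y)
      have h4 : ‖z - y‖ ≤ ‖x - y‖ := norm_sub_le_of_mem_segment hz
      calc ‖fderiv 𝕜 E z‖ ≤ L * ‖z - y‖ := by simp only [L]; linarith
        _ ≤ L * ‖x - y‖ := by gcongr
    have h := (convex_segment y x).norm_image_sub_le_of_norm_fderiv_le
      (fun z hz ↦ hdiff z (hconv.segment_subset hy hx hz)) hbound
      (left_mem_segment ℝ y x) (right_mem_segment ℝ y x)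
    rw [← hEy]
    linarith
  have hsqrt : ‖E x - E x_inf‖ ^ (1 / 2 : ℝ) ≤ √L * ‖x - y‖ := by
    rw [← Real.sqrt_eq_rpow]
    refine (Real.sqrt_le_sqrt hquad).trans_eq ?_
    rw [Real.sqrt_mul hL.le, Real.sqrt_sq (norm_nonneg _)]
  calc c / 2 / √L * ‖E x - E x_inf‖ ^ (1 / 2 : ℝ)
      ≤ c / 2 / √L * (√L * ‖x - y‖) := by gcongr
    _ = c / 2 * ‖x - y‖ := by field_simp
    _ ≤ ‖fderiv 𝕜 E x‖ := hgrad
end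

section
/- Let d ≥ 1 and N ≥ 2 be integers, 𝕂 = ℝ or ℂ, U ⊆ 𝕂^d an open subset, E : U → 𝕂 a C^N function, and x∞ ∈ Crit E. Suppose E is generalized Morse–Bott of order N at x∞ with flat critical locus: there is a 𝕂-linear subspace K ⊆ 𝕂^d such that (a) Crit E ∩ U = (x∞ + K) ∩ U; (b) the n-th derivative E^{(n)}(x) vanishes for every x ∈ Crit E ∩ U and every 1 ≤ n ≤ N−1; and (c) E^{(N)}(x∞)(ξ,…,ξ) ≠ 0 for every nonzero ξ in the orthogonal complement K^⊥ of K in 𝕂^d. Then there exist constants C₀ ∈ (0,∞) and σ₀ ∈ (0,1] with B_{σ₀}(x∞) ⊆ U such that ‖E'(x)‖ ≥ C₀ · |E(x) − E(x∞)|^{1−1/N} for all x ∈ B_{σ₀}(x∞). -/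
open Metric in
/-- Iterated mean value inequality on the closed unit disc: if `h 0, …, h (n - 1)` is a chain of
successive derivatives vanishing at `0` and `h n` stays within `B` of a constant `A`, then
`h 0` stays within `B` of `t ^ n / n! • A`. -/
theorem norm_sub_pow_div_factorial_smul_le {𝕜 F : Type*} [RCLike 𝕜] [NormedAddCommGroup F]
    [NormedSpace 𝕜 F] (n : ℕ) (h : ℕ → 𝕜 → F) (A : F) (B : ℝ)
    (hderiv : ∀ k < n, ∀ t ∈ closedBall (0 : 𝕜) 1, HasDerivAt (h k) (h (k + 1) t) t)
    (hzero : ∀ k < n, h k 0 = 0)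
    (hB : ∀ t ∈ closedBall (0 : 𝕜) 1, ‖h n t - A‖ ≤ B) :
    ∀ t ∈ closedBall (0 : 𝕜) 1, ‖h 0 t - (t ^ n / (n.factorial : 𝕜)) • A‖ ≤ B := by
  induction n generalizing h with
  | zero => simpa using hB
  | succ n ih =>
    intro t ht
    have hstep := ih (fun k => h (k + 1)) (fun k hk => hderiv (k + 1) (by omega))
      (fun k hk => hzero (k + 1) (by omega)) hB
    have hd : ∀ s ∈ closedBall (0 : 𝕜) 1, HasDerivAt
        (fun s : 𝕜 => h 0 s - (s ^ (n + 1) / ((n + 1).factorial : 𝕜)) • A)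
        (h 1 s - (s ^ n / (n.factorial : 𝕜)) • A) s := by
      intro s hs
      have hp : HasDerivAt (fun s : 𝕜 => s ^ (n + 1) / ((n + 1).factorial : 𝕜))
          (s ^ n / (n.factorial : 𝕜)) s := by
        refine ((hasDerivAt_pow (n + 1) s).div_const ((n + 1).factorial : 𝕜)).congr_deriv ?_
        have h1 : (n.factorial : 𝕜) ≠ 0 := Nat.cast_ne_zero.2 n.factorial_ne_zero
        have h2 : ((n : 𝕜) + 1) ≠ 0 := by exact_mod_cast n.succ_ne_zero
        rw [Nat.factorial_succ]
        push_cast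
        field_simp
      exact (hderiv 0 (by omega) s hs).sub (hp.smul_const A)
    have hB0 : 0 ≤ B := (norm_nonneg _).trans (hstep 0 (by simp))
    have hmv := (convex_closedBall (0 : 𝕜) 1).norm_image_sub_le_of_norm_hasDerivWithin_le
      (fun s hs => (hd s hs).hasDerivWithinAt) hstep (by simp : (0 : 𝕜) ∈ closedBall (0 : 𝕜) 1) ht
    simp only [hzero 0 (by omega), ne_eq, Nat.add_eq_zero_iff, one_ne_zero, and_false,
      not_false_eq_true, zero_pow, zero_div, zero_smul, sub_zero] at hmv
    exact hmv.trans (mul_le_of_le_one_right hB0 (by simpa using ht))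

/-- The directional derivatives of successive orders along a line. -/
theorem ContDiffAt.hasDerivAt_iteratedFDeriv_line {𝕜 V F : Type*} [NontriviallyNormedField 𝕜]
    [NormedAddCommGroup V] [NormedSpace 𝕜 V] [NormedAddCommGroup F] [NormedSpace 𝕜 F]
    {f : V → F} {N k : ℕ} {p ξ : V} {t : 𝕜} (hf : ContDiffAt 𝕜 N f (p + t • ξ)) (hk : k < N) :
    HasDerivAt (fun s : 𝕜 => iteratedFDeriv 𝕜 k f (p + s • ξ) (fun _ => ξ))
      (iteratedFDeriv 𝕜 (k + 1) f (p + t • ξ) (fun _ => ξ)) t := by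
  have hdiff : DifferentiableAt 𝕜 (iteratedFDeriv 𝕜 k f) (p + t • ξ) :=
    (hf.iteratedFDeriv_right (m := 1) (i := k) (by exact_mod_cast (by omega : 1 + k ≤ N))
      ).differentiableAt one_ne_zero
  have hline : HasDerivAt (fun s : 𝕜 => p + s • ξ) ξ t := by
    simpa using ((hasDerivAt_id t).smul_const ξ).const_add p
  have hcomp := hdiff.hasFDerivAt.comp_hasDerivAt t hline
  have happ := (ContinuousMultilinearMap.apply 𝕜 (fun _ : Fin k => V) F
    (fun _ => ξ)).hasFDerivAt.comp_hasDerivAt t hcomp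
  rw [iteratedFDeriv_succ_apply_left]
  exact happ

/-- A form which does not vanish on the nonzero vectors of a subspace is coercive there. -/
theorem ContinuousMultilinearMap.exists_pos_mul_norm_pow_le {𝕜 V F : Type*} [RCLike 𝕜]
    [NormedAddCommGroup V] [NormedSpace 𝕜 V] [FiniteDimensional 𝕜 V] [NormedAddCommGroup F]
    [NormedSpace 𝕜 F] {N : ℕ} (T : V [×N]→L[𝕜] F) (L : Submodule 𝕜 V)
    (hT : ∀ ξ ∈ L, ξ ≠ 0 → T (fun _ => ξ) ≠ 0) (hN : N ≠ 0) :
    ∃ m : ℝ, 0 < m ∧ ∀ ξ ∈ L, m * ‖ξ‖ ^ N ≤ ‖T (fun _ => ξ)‖ := by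
  have : ProperSpace V := FiniteDimensional.proper 𝕜 V
  have hcomp : IsCompact (Metric.sphere (0 : V) 1 ∩ L) :=
    (isCompact_sphere 0 1).inter_right L.closed_of_finiteDimensional
  have hcont : Continuous (fun ξ : V => ‖T (fun _ => ξ)‖) := by fun_prop
  obtain ⟨m, hm, hmin⟩ := hcomp.exists_forall_le' hcont.continuousOn (a := 0) (by
    rintro ξ ⟨hξ, hξL⟩
    refine norm_pos_iff.2 (hT ξ hξL ?_)
    rintro rfl
    simp at hξ)
  refine ⟨m, hm, fun ξ hξ => ?_⟩
  rcases eq_or_ne ξ 0 with rfl | hne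
  · simp [hN]
  have hpos : 0 < ‖ξ‖ := norm_pos_iff.2 hne
  have hunit := hmin ((‖ξ‖⁻¹ : 𝕜) • ξ)
    ⟨by simp [norm_smul, hpos.ne'], L.smul_mem _ hξ⟩
  have hhom : T (fun _ => (‖ξ‖⁻¹ : 𝕜) • ξ) = ((‖ξ‖⁻¹ : 𝕜) ^ N) • T (fun _ => ξ) := by
    simpa using T.map_smul_univ (fun _ => (‖ξ‖⁻¹ : 𝕜)) (fun _ => ξ)
  rw [hhom, norm_smul, norm_pow, norm_inv, RCLike.norm_ofReal, abs_norm, inv_pow,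
    inv_mul_eq_div, le_div_iff₀ (by positivity)] at hunit
  exact hunit

/-- Growth estimates along a normal segment issuing from a point where the derivatives of orders
`1, …, N - 1` vanish: if the `N`-th derivative stays within `ε` of `T` along the segment, then
`f' (p + ξ) ξ` is close to `T (ξ, …, ξ) / (N - 1)!` and `f (p + ξ) - f p` is `O(‖ξ‖ ^ N)`. -/
theorem norm_fderiv_sub_le_and_norm_sub_le {𝕜 V F : Type*} [RCLike 𝕜]
    [NormedAddCommGroup V] [NormedSpace 𝕜 V] [NormedAddCommGroup F] [NormedSpace 𝕜 F]
    {f : V → F} {n : ℕ} {p ξ : V} {ε : ℝ} (T : V [×(n + 1)]→L[𝕜] F)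
    (hf : ∀ t ∈ Metric.closedBall (0 : 𝕜) 1, ContDiffAt 𝕜 (n + 1 : ℕ) f (p + t • ξ))
    (hzero : ∀ k : ℕ, 1 ≤ k → k ≤ n → iteratedFDeriv 𝕜 k f p = 0)
    (hT : ∀ t ∈ Metric.closedBall (0 : 𝕜) 1,
      ‖iteratedFDeriv 𝕜 (n + 1) f (p + t • ξ) - T‖ ≤ ε) :
    ‖fderiv 𝕜 f (p + ξ) ξ - ((n.factorial : 𝕜)⁻¹) • T (fun _ => ξ)‖ ≤ ε * ‖ξ‖ ^ (n + 1) ∧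
      ‖f (p + ξ) - f p‖ ≤ (ε + ‖T‖) * ‖ξ‖ ^ (n + 1) := by
  have hmain := norm_sub_pow_div_factorial_smul_le (𝕜 := 𝕜) n
    (fun k s => iteratedFDeriv 𝕜 (k + 1) f (p + s • ξ) (fun _ => ξ)) (T (fun _ => ξ))
    (ε * ‖ξ‖ ^ (n + 1))
    (fun k hk t ht => (hf t ht).hasDerivAt_iteratedFDeriv_line (by omega))
    (fun k hk => by simp [hzero (k + 1) (by omega) (by omega)])
    (fun t ht => by
      have hle := (iteratedFDeriv 𝕜 (n + 1) f (p + t • ξ) - T).le_of_opNorm_le (hT t ht)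
        (fun _ => ξ)
      simpa using hle)
  have hone : (1 : 𝕜) ∈ Metric.closedBall (0 : 𝕜) 1 := by simp
  refine ⟨by simpa using hmain 1 hone, ?_⟩
  have hbound : ∀ t ∈ Metric.closedBall (0 : 𝕜) 1,
      ‖iteratedFDeriv 𝕜 1 f (p + t • ξ) (fun _ => ξ)‖ ≤ (ε + ‖T‖) * ‖ξ‖ ^ (n + 1) := by
    intro t ht
    have hTξ : ‖T (fun _ => ξ)‖ ≤ ‖T‖ * ‖ξ‖ ^ (n + 1) := by
      simpa using T.le_opNorm (fun _ => ξ)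
    have hcoef : ‖t ^ n / (n.factorial : 𝕜)‖ ≤ 1 := by
      rw [norm_div, norm_pow, RCLike.norm_natCast]
      refine div_le_one_of_le₀ ((pow_le_one₀ (norm_nonneg t) (by simpa using ht)).trans ?_)
        (by positivity)
      exact_mod_cast n.factorial_pos
    calc _ ≤ ‖iteratedFDeriv 𝕜 1 f (p + t • ξ) (fun _ => ξ)
            - (t ^ n / (n.factorial : 𝕜)) • T (fun _ => ξ)‖
          + ‖(t ^ n / (n.factorial : 𝕜)) • T (fun _ => ξ)‖ := norm_le_norm_sub_add _ _
      _ ≤ ε * ‖ξ‖ ^ (n + 1) + 1 * (‖T‖ * ‖ξ‖ ^ (n + 1)) := by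
          rw [norm_smul]
          exact add_le_add (hmain t ht)
            (mul_le_mul hcoef hTξ (norm_nonneg _) zero_le_one)
      _ = _ := by ring
  have hd : ∀ t ∈ Metric.closedBall (0 : 𝕜) 1, HasDerivWithinAt (fun s : 𝕜 => f (p + s • ξ))
      (iteratedFDeriv 𝕜 1 f (p + t • ξ) (fun _ => ξ)) (Metric.closedBall (0 : 𝕜) 1) t :=
    fun t ht => by
      simpa using ((hf t ht).hasDerivAt_iteratedFDeriv_line (k := 0) (by omega)).hasDerivWithinAt
  simpa using (convex_closedBall (0 : 𝕜) 1).norm_image_sub_le_of_norm_hasDerivWithin_le hd hbound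
    (by simp : (0 : 𝕜) ∈ Metric.closedBall (0 : 𝕜) 1) hone

/-- **Łojasiewicz gradient inequality for a generalized Morse–Bott function of order `N`
(flat critical locus).** Let `E : U → 𝕜` be `C^N` (`N ≥ 2`) on an open `U ⊆ 𝕜^d`,
`x∞ ∈ Crit E`, and `K ⊆ 𝕜^d` a subspace with (a) `Crit E ∩ U = (x∞ + K) ∩ U`;
(b) `E⁽ⁿ⁾(x) = 0` for every critical point `x ∈ U` and every `1 ≤ n ≤ N−1`; and
(c) `E⁽ᴺ⁾(x∞)(ξ,…,ξ) ≠ 0` for every nonzero `ξ ∈ K^⊥`. Then there are `C₀ ∈ (0,∞)` and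
`σ₀ ∈ (0,1]` with `B_{σ₀}(x∞) ⊆ U` such that
`‖E'(x)‖ ≥ C₀ · |E(x) − E(x∞)|^{1−1/N}` on `B_{σ₀}(x∞)`. -/
theorem lojasiewicz_gradient_inequality_generalized_morse_bott
    (d N : ℕ) (hd : 1 ≤ d) (hN : 2 ≤ N) (𝕜 : Type) [RCLike 𝕜]
    (U : Set (EuclideanSpace 𝕜 (Fin d))) (hU : IsOpen U)
    (E : EuclideanSpace 𝕜 (Fin d) → 𝕜) (hE : ContDiffOn 𝕜 N E U)
    (x_inf : EuclideanSpace 𝕜 (Fin d)) (hx : x_inf ∈ U)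
    (hcrit : fderiv 𝕜 E x_inf = 0)
    (K : Submodule 𝕜 (EuclideanSpace 𝕜 (Fin d)))
    (hcritloc : {x ∈ U | fderiv 𝕜 E x = 0}
      = {x : EuclideanSpace 𝕜 (Fin d) | x - x_inf ∈ K} ∩ U)
    (hvanish : ∀ x ∈ {x ∈ U | fderiv 𝕜 E x = 0}, ∀ n : ℕ, 1 ≤ n → n ≤ N - 1 →
      iteratedFDeriv 𝕜 n E x = 0)
    (hnondeg : ∀ ξ ∈ Kᗮ, ξ ≠ 0 →
      iteratedFDeriv 𝕜 N E x_inf (fun _ => ξ) ≠ 0) :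
    ∃ C₀ : ℝ, 0 < C₀ ∧ ∃ σ₀ ∈ Set.Ioc (0:ℝ) 1, Metric.ball x_inf σ₀ ⊆ U ∧
      ∀ x ∈ Metric.ball x_inf σ₀,
        ‖fderiv 𝕜 E x‖ ≥ C₀ * ‖E x - E x_inf‖ ^ (1 - 1/(N:ℝ)) := by
  obtain ⟨n, rfl⟩ : ∃ n, N = n + 1 := ⟨N - 1, by omega⟩
  have hn : 1 ≤ n := by omega
  set T := iteratedFDeriv 𝕜 (n + 1) E x_inf with hTdef
  obtain ⟨m, hm, hmT⟩ := T.exists_pos_mul_norm_pow_le Kᗮ hnondeg (by omega)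
  have hCD : ∀ x ∈ U, ContDiffAt 𝕜 (n + 1 : ℕ) E x := fun x hx => hE.contDiffAt (hU.mem_nhds hx)
  have hcont : ContinuousAt (iteratedFDeriv 𝕜 (n + 1) E) x_inf :=
    ((hCD x_inf hx).iteratedFDeriv_right (m := 0) (i := n + 1) (by simp)).continuousAt
  have hfac : (0 : ℝ) < n.factorial := by exact_mod_cast n.factorial_pos
  set ε : ℝ := m / (2 * n.factorial) with hε
  have hεpos : 0 < ε := by positivity
  obtain ⟨δ, hδ, hball⟩ := Metric.mem_nhds_iff.1 (Filter.inter_mem (hU.mem_nhds hx)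
    (hcont.preimage_mem_nhds (Metric.closedBall_mem_nhds T hεpos)))
  set D : ℝ := ε + ‖T‖ with hD
  have hDpos : 0 < D := by positivity
  have hcrit_iff : ∀ x ∈ U, fderiv 𝕜 E x = 0 ↔ x - x_inf ∈ K := fun x hxU => by
    have hmem := Set.ext_iff.1 hcritloc x
    simpa [hxU] using hmem
  have hnear : ∀ x ∈ Metric.ball x_inf (min 1 (δ / 2)), ∃ p ξ, x = p + ξ ∧ p - x_inf ∈ K ∧
      ξ ∈ Kᗮ ∧ ‖p - x_inf‖ < δ / 2 ∧ ‖ξ‖ < δ / 2 := by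
    intro x hxB
    have hlt : ‖x - x_inf‖ < δ / 2 :=
      (mem_ball_iff_norm.1 hxB).trans_le (min_le_right _ _)
    refine ⟨x_inf + K.starProjection (x - x_inf), Kᗮ.starProjection (x - x_inf), ?_, ?_, ?_, ?_, ?_⟩
    · rw [add_assoc, K.starProjection_add_starProjection_orthogonal]
      abel
    · rw [add_sub_cancel_left]
      exact Submodule.starProjection_apply_mem _ _
    · exact Submodule.starProjection_apply_mem _ _
    · rw [add_sub_cancel_left]
      exact (K.norm_starProjection_apply_le _).trans_lt hlt
    · exact (Kᗮ.norm_starProjection_apply_le _).trans_lt hlt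
  have hseg : ∀ v w : EuclideanSpace 𝕜 (Fin d), ‖v‖ < δ / 2 → ‖w‖ < δ / 2 →
      ∀ t ∈ Metric.closedBall (0 : 𝕜) 1, x_inf + v + t • w ∈ Metric.ball x_inf δ := by
    intro v w hv hw t ht
    rw [mem_ball_iff_norm, add_assoc, add_sub_cancel_left]
    have htw : ‖t • w‖ ≤ ‖w‖ := by
      rw [norm_smul]
      exact mul_le_of_le_one_left (norm_nonneg w) (by simpa using ht)
    linarith [norm_add_le v (t • w)]
  have hflat : ∀ v ∈ K, ‖v‖ < δ / 2 → E (x_inf + v) = E x_inf := by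
    intro v hvK hv
    have hin : ∀ t ∈ Metric.closedBall (0 : 𝕜) 1, x_inf + t • v ∈ U := fun t ht => by
      simpa using (hball (hseg 0 v (by simpa using hδ) hv t ht)).1
    have hd : ∀ t ∈ Metric.closedBall (0 : 𝕜) 1, HasDerivWithinAt (fun s : 𝕜 => E (x_inf + s • v))
        0 (Metric.closedBall (0 : 𝕜) 1) t := fun t ht => by
      have hfd := (hcrit_iff _ (hin t ht)).2 (by simpa using K.smul_mem t hvK)
      simpa [hfd] using ((hCD _ (hin t ht)).hasDerivAt_iteratedFDeriv_line
        (k := 0) (by omega)).hasDerivWithinAt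
    have hmv := (convex_closedBall (0 : 𝕜) 1).norm_image_sub_le_of_norm_hasDerivWithin_le
      (C := 0) (x := 0) (y := 1) hd (by simp) (by simp) (by simp)
    simpa [sub_eq_zero] using hmv
  refine ⟨ε / D ^ (1 - 1 / ((n + 1 : ℕ) : ℝ)), by positivity, min 1 (δ / 2),
    ⟨by positivity, min_le_left _ _⟩, fun x hxB => (hball (Metric.ball_subset_ball
      ((min_le_right _ _).trans (by linarith)) hxB)).1, fun x hxB => ?_⟩
  obtain ⟨p, ξ, rfl, hpK, hξK, hp, hξ⟩ := hnear x hxB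
  have hsegp : ∀ t ∈ Metric.closedBall (0 : 𝕜) 1, p + t • ξ ∈ Metric.ball x_inf δ := fun t ht => by
    simpa using hseg _ ξ hp hξ t ht
  have hpU : p ∈ U := by simpa using (hball (hsegp 0 (by simp))).1
  have hEp : E p = E x_inf := by simpa using hflat _ hpK hp
  obtain ⟨hgrad, hval⟩ := norm_fderiv_sub_le_and_norm_sub_le (ε := ε) (p := p) (ξ := ξ) T
    (fun t ht => hCD _ (hball (hsegp t ht)).1)
    (fun k hk hkn => hvanish p ⟨hpU, (hcrit_iff p hpU).2 hpK⟩ k hk (by omega))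
    (fun t ht => mem_closedBall_iff_norm.1 (hball (hsegp t ht)).2)
  rw [hEp] at hval
  have hlower : ε * ‖ξ‖ ^ n ≤ ‖fderiv 𝕜 E (p + ξ)‖ := by
    rcases eq_or_ne ξ 0 with rfl | hne
    · simp [show n ≠ 0 by omega]
    have hpos : 0 < ‖ξ‖ := norm_pos_iff.2 hne
    have hlead : 2 * ε * ‖ξ‖ ^ (n + 1) ≤ ‖((n.factorial : 𝕜)⁻¹) • T (fun _ => ξ)‖ := by
      rw [norm_smul, norm_inv, RCLike.norm_natCast, inv_mul_eq_div, le_div_iff₀ hfac, hε]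
      refine le_trans (le_of_eq ?_) (hmT ξ hξK)
      field_simp
    have htri := norm_le_norm_add_norm_sub (fderiv 𝕜 E (p + ξ) ξ)
      (((n.factorial : 𝕜)⁻¹) • T (fun _ => ξ))
    have hop := (fderiv 𝕜 E (p + ξ)).le_opNorm ξ
    refine le_of_mul_le_mul_right ?_ hpos
    calc ε * ‖ξ‖ ^ n * ‖ξ‖ = 2 * ε * ‖ξ‖ ^ (n + 1) - ε * ‖ξ‖ ^ (n + 1) := by ring
      _ ≤ _ := by linarith
  have hexp : (0 : ℝ) ≤ 1 - 1 / ((n + 1 : ℕ) : ℝ) := by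
    rw [sub_nonneg, div_le_one (by positivity)]
    exact_mod_cast Nat.succ_pos n
  have hpow : (‖ξ‖ ^ (n + 1)) ^ (1 - 1 / ((n + 1 : ℕ) : ℝ)) = ‖ξ‖ ^ n := by
    rw [← Real.rpow_natCast, ← Real.rpow_mul (norm_nonneg _), ← Real.rpow_natCast]
    congr 1
    push_cast
    field_simp
    ring
  calc ε / D ^ (1 - 1 / ((n + 1 : ℕ) : ℝ)) * ‖E (p + ξ) - E x_inf‖ ^ (1 - 1 / ((n + 1 : ℕ) : ℝ))
      ≤ ε / D ^ (1 - 1 / ((n + 1 : ℕ) : ℝ)) *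
        (D * ‖ξ‖ ^ (n + 1)) ^ (1 - 1 / ((n + 1 : ℕ) : ℝ)) := by gcongr
    _ = ε * ‖ξ‖ ^ n := by
      rw [Real.mul_rpow hDpos.le (by positivity), hpow]
      field_simp
    _ ≤ ‖fderiv 𝕜 E (p + ξ)‖ := hlower
end

section
/- Let d ≥ 1 be an integer, U ⊆ ℝ^d an open neighborhood of the origin, and F : U → ℝ a C¹ function with F(0) = 0, F'(0) = 0, and F ≥ 0 on U, satisfying the Łojasiewicz gradient inequality: there are C ∈ (0,∞), σ ∈ (0,1], θ ∈ [1/2,1) with B_σ ⊆ U and ‖F'(x)‖ ≥ C·F(x)^θ for all x ∈ B_σ. Then there is a constant δ ∈ (0, σ/4] such that for each x ∈ B_δ there exists a map 𝐱 : [0,∞) → ℝ^d, continuous on [0,∞) and C¹ on (0,∞), with 𝐱(0) = x, satisfying the negative gradient flow equation d𝐱/dt = −∇F(𝐱(t)) for all t > 0, such that 𝐱(t) ∈ B_{σ/2} for all t ∈ [0,∞) and 𝐱(t) converges in ℝ^d as t → ∞ to a point 𝐱∞ ∈ B_σ ∩ Crit F. -/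
open Filter Topology Set

/-- The iterates of the explicit Euler scheme with step `h` for the vector field `v`. -/
def eulerIterate {E : Type*} [AddCommGroup E] [Module ℝ E] (v : E → E) (h : ℝ) (x : E) (k : ℕ) :
    E :=
  (fun y => y + h • v y)^[k] x

theorem eulerIterate_succ {E : Type*} [AddCommGroup E] [Module ℝ E] (v : E → E) (h : ℝ) (x : E)
    (k : ℕ) :
    eulerIterate v h x (k + 1) = eulerIterate v h x k + h • v (eulerIterate v h x k) := by
  simp only [eulerIterate, Function.iterate_succ_apply']

section Peano

variable {E : Type*} [NormedAddCommGroup E] [NormedSpace ℝ E] {v : E → E}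

theorem norm_eulerIterate_sub_sub_smul_le {h : ℝ} (hh : 0 ≤ h) (x w : E) {ε : ℝ} {m n : ℕ}
    (hmn : m ≤ n) (hw : ∀ k, m ≤ k → k < n → ‖v (eulerIterate v h x k) - w‖ ≤ ε) :
    ‖eulerIterate v h x n - eulerIterate v h x m - (((n : ℝ) - m) * h) • w‖ ≤
      ε * (((n : ℝ) - m) * h) := by
  induction n, hmn using Nat.le_induction with
  | base => simp
  | succ n hmn ih =>
    have h1 := ih fun k hk hkn => hw k hk (hkn.trans n.lt_succ_self)
    have h2 := hw n hmn n.lt_succ_self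
    have h3 : eulerIterate v h x (n + 1) - eulerIterate v h x m
          - ((((n + 1 : ℕ) : ℝ) - m) * h) • w
        = (eulerIterate v h x n - eulerIterate v h x m - (((n : ℝ) - m) * h) • w)
          + h • (v (eulerIterate v h x n) - w) := by
      rw [eulerIterate_succ]
      push_cast
      module
    rw [h3]
    refine (norm_add_le _ _).trans ?_
    rw [norm_smul, Real.norm_of_nonneg hh]
    push_cast
    nlinarith [mul_le_mul_of_nonneg_left h2 hh]

theorem norm_eulerIterate_sub_le {M : ℝ} (hM : ∀ y, ‖v y‖ ≤ M) {h : ℝ} (hh : 0 ≤ h) (x : E)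
    {m n : ℕ} (hmn : m ≤ n) :
    ‖eulerIterate v h x n - eulerIterate v h x m‖ ≤ M * (((n : ℝ) - m) * h) := by
  simpa using norm_eulerIterate_sub_sub_smul_le (v := v) (ε := M) hh x 0 hmn
    fun k _ _ => by simpa using hM _

/-- **Peano existence theorem**, global version for a bounded continuous vector field. -/
theorem exists_forall_hasDerivWithinAt_of_continuous_of_bounded [ProperSpace E]
    (hv : Continuous v) {M : ℝ} (hM : ∀ y, ‖v y‖ ≤ M) (x : E) :
    ∃ X : ℝ → E, X 0 = x ∧ ∀ t, 0 ≤ t → HasDerivWithinAt X (v (X t)) (Ici 0) t := by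
  have hM0 : 0 ≤ M := (norm_nonneg _).trans (hM 0)
  set h : ℕ → ℝ := fun n => ((n : ℝ) + 1)⁻¹ with hh
  have hhpos : ∀ n, 0 < h n := fun n => by positivity
  set N : ℕ → ℝ → ℕ := fun n t => ⌊t * ((n : ℝ) + 1)⌋₊ with hN
  set Y : ℕ → ℝ → E := fun n t => eulerIterate v (h n) x (N n t) with hY
  set 𝒰 : Ultrafilter ℕ := hyperfilter ℕ
  have h𝒰top : (𝒰 : Filter ℕ) ≤ atTop := Nat.hyperfilter_le_atTop
  have hNmono : ∀ n, Monotone (N n) := fun n s t hst =>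
    Nat.floor_mono (mul_le_mul_of_nonneg_right hst (by positivity))
  have hNlim : ∀ t, 0 ≤ t → Tendsto (fun n => (N n t : ℝ) * h n) 𝒰 (𝓝 t) := by
    intro t ht
    have h1 : Tendsto (fun n : ℕ => (n : ℝ) + 1) atTop atTop :=
      tendsto_atTop_add_const_right _ _ tendsto_natCast_atTop_atTop
    have h2 := ((tendsto_nat_floor_mul_div_atTop ht).comp h1).mono_left h𝒰top
    simpa [Function.comp_def, div_eq_mul_inv] using h2
  have hlim : ∀ t, ∃ z, 0 ≤ t → Tendsto (fun n => Y n t) 𝒰 (𝓝 z) := by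
    intro t
    by_cases ht : 0 ≤ t
    · have hmem : ∀ n, Y n t ∈ Metric.closedBall x (M * t) := by
        intro n
        have h1 := norm_eulerIterate_sub_le hM (hhpos n).le x (Nat.zero_le (N n t))
        have h2 : (N n t : ℝ) * h n ≤ t := by
          have h3 : (N n t : ℝ) ≤ t * ((n : ℝ) + 1) := Nat.floor_le (by positivity)
          calc (N n t : ℝ) * h n ≤ t * ((n : ℝ) + 1) * h n :=
                mul_le_mul_of_nonneg_right h3 (hhpos n).le
            _ = t := by simp only [hh]; field_simp
        rw [mem_closedBall_iff_norm]
        refine h1.trans ?_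
        simpa using mul_le_mul_of_nonneg_left h2 hM0
      obtain ⟨z, -, hz⟩ := (isCompact_closedBall x (M * t)).ultrafilter_le_nhds
        (𝒰.map fun n => Y n t) (by
          rw [le_principal_iff]
          exact Filter.mem_map.2 (Filter.univ_mem' hmem))
      exact ⟨z, fun _ => hz⟩
    · exact ⟨x, fun h0 => absurd h0 ht⟩
  choose X hX using hlim
  refine ⟨X, ?_, fun t ht => ?_⟩
  · refine tendsto_nhds_unique (hX 0 le_rfl) ?_
    simp [hY, hN, eulerIterate]
  rw [hasDerivWithinAt_iff_isLittleO, Asymptotics.isLittleO_iff]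
  intro ε hε
  obtain ⟨η, hη, hvη⟩ := Metric.continuousAt_iff.1 (hv.continuousAt (x := X t)) ε hε
  have key : ∀ a b, 0 ≤ a → a ≤ t → t ≤ b → M * (b - a) < η / 2 →
      ‖X b - X a - (b - a) • v (X t)‖ ≤ ε * (b - a) := by
    intro a b ha hat htb hab
    have hb : 0 ≤ b := ht.trans htb
    have hdiff : Tendsto (fun n => ((N n b : ℝ) - N n a) * h n) 𝒰 (𝓝 (b - a)) := by
      simpa only [sub_mul] using (hNlim b hb).sub (hNlim a ha)
    have hL := (((hX b hb).sub (hX a ha)).sub (hdiff.smul_const (v (X t)))).norm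
    refine le_of_tendsto_of_tendsto hL (hdiff.const_mul ε) ?_
    have h1 : ∀ᶠ n in (𝒰 : Filter ℕ), M * (((N n b : ℝ) - N n a) * h n) < η / 2 :=
      (hdiff.const_mul M).eventually_lt_const hab
    have h2 : ∀ᶠ n in (𝒰 : Filter ℕ), dist (Y n t) (X t) < η / 2 :=
      (hX t ht).eventually (Metric.ball_mem_nhds _ (half_pos hη))
    filter_upwards [h1, h2] with n hn1 hn2
    refine norm_eulerIterate_sub_sub_smul_le (hhpos n).le x _ (hNmono n (hat.trans htb)) ?_
    intro k hak hkb
    rw [← dist_eq_norm]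
    refine (hvη ?_).le
    have hNa : (N n a : ℝ) ≤ N n t := by exact_mod_cast hNmono n hat
    have hNb : (N n t : ℝ) ≤ N n b := by exact_mod_cast hNmono n htb
    have hka : (N n a : ℝ) ≤ k := by exact_mod_cast hak
    have hkb' : (k : ℝ) ≤ N n b := by exact_mod_cast hkb.le
    have h3 : dist (eulerIterate v (h n) x k) (Y n t) ≤ M * (((N n b : ℝ) - N n a) * h n) := by
      rcases le_total k (N n t) with hk | hk
      · rw [dist_comm, dist_eq_norm]
        refine (norm_eulerIterate_sub_le hM (hhpos n).le x hk).trans ?_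
        gcongr
      · rw [dist_eq_norm]
        refine (norm_eulerIterate_sub_le hM (hhpos n).le x hk).trans ?_
        gcongr
    linarith [dist_triangle (eulerIterate v (h n) x k) (Y n t) (X t)]
  have hnear : ∀ᶠ s in 𝓝[Ici 0] t, M * |s - t| < η / 2 := by
    have : Continuous fun s : ℝ => M * |s - t| := by fun_prop
    refine nhdsWithin_le_nhds (this.continuousAt.eventually_lt_const ?_)
    simpa using half_pos hη
  filter_upwards [hnear, self_mem_nhdsWithin] with s hs hs0
  rw [Real.norm_eq_abs]
  rcases le_total s t with hst | hst
  · rw [abs_of_nonpos (sub_nonpos.2 hst)] at hs ⊢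
    have h1 := key s t hs0 hst le_rfl (by linarith)
    have h2 : X s - X t - (s - t) • v (X t) = -(X t - X s - (t - s) • v (X t)) := by module
    rwa [h2, norm_neg, neg_sub]
  · rw [abs_of_nonneg (sub_nonneg.2 hst)] at hs ⊢
    exact key t s ht le_rfl hst hs

end Peano

section GradientFlow

variable {E : Type*} [NormedAddCommGroup E]

/-- A curve whose velocity has a limit can only converge if that limit vanishes. -/
theorem eq_zero_of_tendsto_of_tendsto_hasDerivWithinAt [NormedSpace ℝ E] {X X' : ℝ → E} {z w : E}
    (hX : ∀ t, 0 ≤ t → HasDerivWithinAt X (X' t) (Ici 0) t) (hz : Tendsto X atTop (𝓝 z))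
    (hw : Tendsto X' atTop (𝓝 w)) : w = 0 := by
  rw [← norm_le_zero_iff]
  refine le_of_forall_pos_le_add fun ε hε => ?_
  rw [zero_add]
  have hlim : Tendsto (fun t => ‖X (t + 1) - X t - w‖) atTop (𝓝 ‖w‖) := by
    have h1 := (((hz.comp (tendsto_atTop_add_const_right atTop 1 tendsto_id)).sub hz).sub
      (tendsto_const_nhds (x := w))).norm
    simpa using h1
  refine le_of_tendsto hlim ?_
  obtain ⟨T, hT⟩ := eventually_atTop.1 (hw.eventually (Metric.ball_mem_nhds w hε))
  filter_upwards [eventually_ge_atTop (max T 0)] with t ht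
  have ht0 : 0 ≤ t := (le_max_right _ _).trans ht
  have hder : ∀ s ∈ Icc t (t + 1),
      HasDerivWithinAt (fun s => X s - s • w) (X' s - w) (Icc t (t + 1)) s := by
    intro s hs
    have h2 : HasDerivWithinAt X (X' s) (Icc t (t + 1)) s :=
      (hX s (ht0.trans hs.1)).mono fun r hr => ht0.trans hr.1
    have h3 : HasDerivWithinAt (fun r : ℝ => r • w) ((1 : ℝ) • w) (Icc t (t + 1)) s :=
      (hasDerivWithinAt_id s _).smul_const w
    rw [one_smul] at h3
    exact h2.sub h3
  have hbd : ∀ s ∈ Icc t (t + 1), ‖X' s - w‖ ≤ ε := by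
    intro s hs
    rw [← dist_eq_norm]
    exact (hT s ((le_max_left _ _).trans (ht.trans hs.1))).le
  have h1 := (convex_Icc t (t + 1)).norm_image_sub_le_of_norm_hasDerivWithin_le hder hbd
    (left_mem_Icc.2 (by linarith)) (right_mem_Icc.2 (by linarith))
  have h2 : X (t + 1) - (t + 1) • w - (X t - t • w) = X (t + 1) - X t - w := by module
  simpa [h2] using h1

variable [InnerProductSpace ℝ E] [CompleteSpace E] {F : E → ℝ} {U : Set E}

theorem norm_gradient (F : E → ℝ) (x : E) : ‖gradient F x‖ = ‖fderiv ℝ F x‖ := by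
  simp [gradient]

theorem continuousOn_gradient (hU : IsOpen U) (hF : ContDiffOn ℝ 1 F U) :
    ContinuousOn (gradient F) U :=
  (InnerProductSpace.toDual ℝ E).symm.continuous.comp_continuousOn
    (hF.continuousOn_fderiv_of_isOpen hU le_rfl)

theorem HasDerivWithinAt.comp_gradient_flow {X : ℝ → E} {s : Set ℝ} {t : ℝ}
    (hF : DifferentiableAt ℝ F (X t)) (hX : HasDerivWithinAt X (-gradient F (X t)) s t) :
    HasDerivWithinAt (fun r => F (X r)) (-‖gradient F (X t)‖ ^ 2) s t := by
  have h := hF.hasGradientAt.hasFDerivAt.comp_hasDerivWithinAt t hX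
  rw [map_neg, InnerProductSpace.toDual_apply_apply, real_inner_self_eq_norm_sq] at h
  exact h

/-- **Łojasiewicz length estimate**: along the negative gradient flow, the distance travelled is
controlled by the drop of `F ^ (1 - θ)`. -/
theorem norm_sub_le_of_lojasiewicz (hU : IsOpen U) (hF : ContDiffOn ℝ 1 F U)
    (hnn : ∀ x ∈ U, 0 ≤ F x) {K : Set E} (hK : K ⊆ U) {C θ : ℝ} (hC : 0 < C) (hθ : θ < 1)
    (hLoj : ∀ x ∈ K, C * F x ^ θ ≤ ‖fderiv ℝ F x‖) {X : ℝ → E} {a b : ℝ} (hab : a ≤ b)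
    (hXK : ∀ t ∈ Icc a b, X t ∈ K) (hXc : ContinuousOn X (Icc a b))
    (hX : ∀ t ∈ Ico a b, HasDerivWithinAt X (-gradient F (X t)) (Ici t) t) :
    ‖X b - X a‖ ≤ (F (X a) ^ (1 - θ) - F (X b) ^ (1 - θ)) / (C * (1 - θ)) := by
  have hθ' : 0 < 1 - θ := sub_pos.2 hθ
  have hφc : ContinuousOn (fun t => F (X t)) (Icc a b) :=
    hF.continuousOn.comp hXc fun t ht => hK (hXK t ht)
  have hφ : ∀ t ∈ Ico a b,
      HasDerivWithinAt (fun r => F (X r)) (-‖gradient F (X t)‖ ^ 2) (Ici t) t := fun t ht =>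
    (hX t ht).comp_gradient_flow <| (hF.differentiableOn one_ne_zero).differentiableAt <|
      hU.mem_nhds (hK (hXK t (Ico_subset_Icc_self ht)))
  have hzero : ∀ s ∈ Ico a b, F (X s) = 0 → ∀ t ∈ Icc s b, F (X t) = 0 := by
    intro s hs hs0 t ht
    refine le_antisymm ?_ (hnn _ (hK (hXK t ⟨hs.1.trans ht.1, ht.2⟩)))
    exact image_le_of_deriv_right_le_deriv_boundary (f := fun r => F (X r))
      (f' := fun r => -‖gradient F (X r)‖ ^ 2) (B := fun _ => 0) (B' := fun _ => 0)
      (hφc.mono (Icc_subset_Icc_left hs.1))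
      (fun r hr => hφ r ⟨hs.1.trans hr.1, hr.2⟩) hs0.le continuousOn_const
      (fun r _ => hasDerivWithinAt_const _ _ _)
      (fun r _ => neg_nonpos.2 (sq_nonneg _)) ht
  have hpow : ∀ t ∈ Ico a b, HasDerivWithinAt (fun r => F (X r) ^ (1 - θ))
      (if F (X t) = 0 then 0 else -‖gradient F (X t)‖ ^ 2 * (1 - θ) * F (X t) ^ (-θ))
      (Ici t) t := by
    intro t ht
    split_ifs with h0
    · refine (hasDerivWithinAt_const t (Ici t) (0 : ℝ)).congr_of_eventuallyEq_of_mem ?_ self_mem_Ici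
      filter_upwards [Icc_mem_nhdsGE ht.2] with r hr
      rw [hzero t ht h0 r hr, Real.zero_rpow hθ'.ne']
    · have h1 := (hφ t ht).rpow_const (p := 1 - θ) (Or.inl h0)
      rwa [show 1 - θ - 1 = -θ by ring] at h1
  refine image_norm_le_of_norm_deriv_right_le_deriv_boundary' (f := fun t => X t - X a)
    (f' := fun t => -gradient F (X t))
    (B := fun t => (F (X a) ^ (1 - θ) - F (X t) ^ (1 - θ)) / (C * (1 - θ)))
    (B' := fun t => (-if F (X t) = 0 then 0 else
      -‖gradient F (X t)‖ ^ 2 * (1 - θ) * F (X t) ^ (-θ)) / (C * (1 - θ)))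
    (hXc.sub continuousOn_const) (fun t ht => (hX t ht).sub_const _) (by simp)
    ((continuousOn_const.sub (hφc.rpow_const fun _ _ => Or.inr hθ'.le)).div_const _)
    (fun t ht => ((hpow t ht).const_sub _).div_const _) ?_ (right_mem_Icc.2 hab)
  intro t ht
  have htK := hXK t (Ico_subset_Icc_self ht)
  rw [norm_neg]
  split_ifs with h0
  · have hmin : IsLocalMin F (X t) := by
      filter_upwards [hU.mem_nhds (hK htK)] with y hy
      exact h0 ▸ hnn y hy
    simp [norm_gradient, hmin.fderiv_eq_zero]
  · have hpos : 0 < F (X t) := (hnn _ (hK htK)).lt_of_ne' h0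
    have h1 := hLoj _ htK
    rw [← norm_gradient] at h1
    rw [le_div_iff₀ (by positivity), Real.rpow_neg hpos.le, neg_mul, neg_mul, neg_neg,
      ← div_eq_mul_inv, le_div_iff₀ (by positivity)]
    nlinarith [mul_le_mul_of_nonneg_left h1 (mul_nonneg hθ'.le (norm_nonneg (gradient F (X t))))]

end GradientFlow

/-- A curve whose increments are controlled by the drop of a nonnegative function converges. -/
theorem exists_tendsto_of_norm_sub_le {E : Type*} [NormedAddCommGroup E] [CompleteSpace E]
    {X : ℝ → E} {G : ℝ → ℝ} (hG : ∀ t, 0 ≤ t → 0 ≤ G t)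
    (hX : ∀ a b, 0 ≤ a → a ≤ b → ‖X b - X a‖ ≤ G a - G b) :
    ∃ z, Tendsto X atTop (𝓝 z) := by
  refine cauchySeq_tendsto_of_complete (Metric.cauchySeq_iff'.2 fun ε hε => ?_)
  have hne : (G '' Ici 0).Nonempty := nonempty_Ici.image G
  have hbdd : BddBelow (G '' Ici 0) := ⟨0, by rintro _ ⟨t, ht, rfl⟩; exact hG t ht⟩
  obtain ⟨_, ⟨a, ha, rfl⟩, haε⟩ := Real.lt_sInf_add_pos hne hε
  refine ⟨a, fun b hb => ?_⟩
  have h1 : sInf (G '' Ici 0) ≤ G b := csInf_le hbdd ⟨b, le_trans ha hb, rfl⟩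
  rw [dist_eq_norm]
  linarith [hX a b ha hb]

/-- Peano existence for a field that is continuous on a closed ball: there is a global curve that
solves the equation whenever it lies in the ball. -/
theorem exists_hasDerivWithinAt_of_continuousOn_closedBall {E : Type*} [NormedAddCommGroup E]
    [NormedSpace ℝ E] [ProperSpace E] {v : E → E} {R : ℝ} (hR : 0 < R)
    (hv : ContinuousOn v (Metric.closedBall 0 R)) (x : E) :
    ∃ X : ℝ → E, X 0 = x ∧ ∀ t, 0 ≤ t →
      ∃ w, HasDerivWithinAt X w (Ici 0) t ∧ (X t ∈ Metric.closedBall 0 R → w = v (X t)) := by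
  set r : E → E := fun y => (R / max R ‖y‖) • y with hr
  have hmax : ∀ y : E, 0 < max R ‖y‖ := fun y => lt_max_of_lt_left hR
  have hrc : Continuous r :=
    (continuous_const.div (continuous_const.max continuous_norm) fun y => (hmax y).ne').smul
      continuous_id
  have hrR : ∀ y, r y ∈ Metric.closedBall 0 R := by
    intro y
    rw [mem_closedBall_zero_iff, hr, norm_smul, Real.norm_of_nonneg (div_pos hR (hmax y)).le,
      div_mul_eq_mul_div, div_le_iff₀ (hmax y)]
    exact mul_le_mul_of_nonneg_left (le_max_right _ _) hR.le
  obtain ⟨M, hM⟩ := (isCompact_closedBall (0 : E) R).exists_bound_of_continuousOn hv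
  obtain ⟨X, hX0, hX⟩ := exists_forall_hasDerivWithinAt_of_continuous_of_bounded
    (hv.comp_continuous hrc hrR) (fun y => hM (r y) (hrR y)) x
  refine ⟨X, hX0, fun t ht => ⟨_, hX t ht, fun hXR => ?_⟩⟩
  rw [mem_closedBall_zero_iff] at hXR
  simp [hr, max_eq_left hXR, div_self hR.ne']

/-- **Existence and convergence of solutions to the negative gradient flow.** Let
`F : U → ℝ` be `C¹` on a neighborhood of the origin in `ℝ^d`, with `F(0) = 0`, `F'(0) = 0`,
`F ≥ 0` on `U`, satisfying the Łojasiewicz gradient inequality `‖F'(x)‖ ≥ C·F(x)^θ` on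
`B_σ ⊆ U` with `C > 0`, `σ ∈ (0,1]`, `θ ∈ [1/2,1)`. Then there is `δ ∈ (0,σ/4]` such that
for each `x ∈ B_δ` there is a map `𝐱 : [0,∞) → ℝ^d`, continuous on `[0,∞)` and `C¹` on
`(0,∞)`, with `𝐱(0) = x`, solving `d𝐱/dt = −∇F(𝐱(t))`, staying in `B_{σ/2}`, and converging
as `t → ∞` to a point of `B_σ ∩ Crit F`. -/
theorem gradient_flow_existence_convergence
    (d : ℕ) (hd : 1 ≤ d)
    (U : Set (EuclideanSpace ℝ (Fin d))) (hU : IsOpen U)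
    (hU0 : (0 : EuclideanSpace ℝ (Fin d)) ∈ U)
    (F : EuclideanSpace ℝ (Fin d) → ℝ) (hF : ContDiffOn ℝ 1 F U)
    (hF0 : F 0 = 0) (hdF0 : fderiv ℝ F 0 = 0) (hnn : ∀ x ∈ U, 0 ≤ F x)
    (C σ θ : ℝ) (hC : 0 < C) (hσ : σ ∈ Set.Ioc (0:ℝ) 1) (hθ : θ ∈ Set.Ico (1/2 : ℝ) 1)
    (hball : Metric.ball (0 : EuclideanSpace ℝ (Fin d)) σ ⊆ U)
    (hLoj : ∀ x ∈ Metric.ball (0 : EuclideanSpace ℝ (Fin d)) σ,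
      ‖fderiv ℝ F x‖ ≥ C * (F x) ^ θ) :
    ∃ δ ∈ Set.Ioc (0:ℝ) (σ/4),
      ∀ x ∈ Metric.ball (0 : EuclideanSpace ℝ (Fin d)) δ,
        ∃ X : ℝ → EuclideanSpace ℝ (Fin d),
          ContinuousOn X (Set.Ici (0:ℝ)) ∧
          ContDiffOn ℝ 1 X (Set.Ioi (0:ℝ)) ∧
          X 0 = x ∧
          (∀ t ∈ Set.Ioi (0:ℝ), HasDerivAt X (-(gradient F (X t))) t) ∧
          (∀ t ∈ Set.Ici (0:ℝ), X t ∈ Metric.ball (0 : EuclideanSpace ℝ (Fin d)) (σ/2)) ∧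
          ∃ x_lim ∈ Metric.ball (0 : EuclideanSpace ℝ (Fin d)) σ ∩
              {y ∈ U | fderiv ℝ F y = 0},
            Filter.Tendsto X Filter.atTop (nhds x_lim) := by
  obtain ⟨hσ0, hσ1⟩ := hσ
  have hθ0 : 0 < 1 - θ := sub_pos.2 hθ.2
  set D : ℝ := C * (1 - θ)
  have hDpos : 0 < D := mul_pos hC hθ0
  have hKσ : Metric.closedBall (0 : EuclideanSpace ℝ (Fin d)) (σ / 2) ⊆ Metric.ball 0 σ :=
    Metric.closedBall_subset_ball (half_lt_self hσ0)
  have hKU := hKσ.trans hball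
  have hgradc := continuousOn_gradient hU hF
  have hFsmall : ∀ᶠ x in 𝓝 (0 : EuclideanSpace ℝ (Fin d)), F x ^ (1 - θ) / D < σ / 4 := by
    have h1 : ContinuousAt (fun x => F x ^ (1 - θ) / D) 0 :=
      ((hF.continuousOn.continuousAt (hU.mem_nhds hU0)).rpow_const (Or.inr hθ0.le)).div_const D
    refine h1.eventually_lt_const ?_
    simp only [hF0, Real.zero_rpow hθ0.ne', zero_div]
    positivity
  obtain ⟨δ₀, hδ₀, hδF⟩ := Metric.eventually_nhds_iff_ball.1 hFsmall
  refine ⟨min δ₀ (σ / 4), ⟨lt_min hδ₀ (by positivity), min_le_right _ _⟩, fun x hx => ?_⟩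
  have hxδ : x ∈ Metric.ball (0 : EuclideanSpace ℝ (Fin d)) δ₀ :=
    Metric.ball_subset_ball (min_le_left _ _) hx
  have hxσ : ‖x‖ < σ / 4 := mem_ball_zero_iff.1 (Metric.ball_subset_ball (min_le_right _ _) hx)
  obtain ⟨X, hX0, hX⟩ := exists_hasDerivWithinAt_of_continuousOn_closedBall (half_pos hσ0)
    (v := fun y => -gradient F y)
    (hgradc.mono hKU).neg x
  have hXc : ContinuousOn X (Ici 0) := by
    intro t ht
    obtain ⟨w, hw, -⟩ := hX t ht
    exact hw.continuousWithinAt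
  have hlen : ∀ a b, 0 ≤ a → a ≤ b →
      (∀ t ∈ Icc 0 b, X t ∈ Metric.closedBall (0 : EuclideanSpace ℝ (Fin d)) (σ / 2)) →
      ‖X b - X a‖ ≤ (F (X a) ^ (1 - θ) - F (X b) ^ (1 - θ)) / D := by
    intro a b ha hab hXK
    refine norm_sub_le_of_lojasiewicz hU hF hnn hKU hC hθ.2 (fun y hy => hLoj y (hKσ hy)) hab
      (fun t ht => hXK t ⟨ha.trans ht.1, ht.2⟩) (hXc.mono fun t ht => ha.trans ht.1)
      fun t ht => ?_
    obtain ⟨w, hw, hwX⟩ := hX t (ha.trans ht.1)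
    rw [← hwX (hXK t ⟨ha.trans ht.1, ht.2.le⟩)]
    exact hw.mono fun r hr => (ha.trans ht.1).trans hr
  have hpow_nonneg : ∀ {t}, X t ∈ Metric.closedBall (0 : EuclideanSpace ℝ (Fin d)) (σ / 2) →
      0 ≤ F (X t) ^ (1 - θ) := fun h => Real.rpow_nonneg (hnn _ (hKU h)) _
  have hstay : ∀ t, 0 ≤ t → ‖X t‖ < σ / 2 := by
    by_contra! hcon
    set S : Set ℝ := Ici 0 ∩ (fun t => ‖X t‖) ⁻¹' Ici (σ / 2)
    have hSne : S.Nonempty := by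
      obtain ⟨t, ht0, ht⟩ := hcon
      exact ⟨t, ht0, ht⟩
    have hSbdd : BddBelow S := ⟨0, fun t ht => ht.1⟩
    have hScl : IsClosed S := hXc.norm.preimage_isClosed_of_isClosed isClosed_Ici isClosed_Ici
    obtain ⟨hT0, hT⟩ := hScl.csInf_mem hSne hSbdd
    set T := sInf S
    have hlt : ∀ t ∈ Ico 0 T, ‖X t‖ < σ / 2 := by
      intro t ht
      by_contra! h
      exact (csInf_le hSbdd ⟨ht.1, h⟩).not_gt ht.2
    have hTpos : (0 : ℝ) ≠ T := by
      intro h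
      rw [← h, mem_preimage, hX0, mem_Ici] at hT
      linarith
    have hXK : ∀ t ∈ Icc 0 T,
        X t ∈ Metric.closedBall (0 : EuclideanSpace ℝ (Fin d)) (σ / 2) := by
      have h1 : closure (Ico 0 T) = Icc 0 T := closure_Ico hTpos
      rw [← h1]
      intro t ht
      refine Metric.isClosed_closedBall.closure_subset_iff.2 (image_subset_iff.2 fun s hs => ?_)
        ((hXc.mono ?_).image_closure ⟨t, ht, rfl⟩)
      · exact mem_closedBall_zero_iff.2 (hlt s hs).le
      · rw [h1]; exact fun s hs => hs.1
    have h1 := hlen 0 T le_rfl hT0 hXK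
    rw [hX0, sub_div] at h1
    have h2 : 0 ≤ F (X T) ^ (1 - θ) / D :=
      div_nonneg (hpow_nonneg (hXK T (right_mem_Icc.2 hT0))) hDpos.le
    have h3 := hδF x hxδ
    have h4 : ‖X T‖ ≤ ‖X T - x‖ + ‖x‖ := by simpa using norm_add_le (X T - x) x
    have h5 : σ / 2 ≤ ‖X T‖ := hT
    linarith
  have hstayK : ∀ t, 0 ≤ t → X t ∈ Metric.closedBall (0 : EuclideanSpace ℝ (Fin d)) (σ / 2) :=
    fun t ht => mem_closedBall_zero_iff.2 (hstay t ht).le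
  have hXflow : ∀ t, 0 ≤ t → HasDerivWithinAt X (-gradient F (X t)) (Ici 0) t := by
    intro t ht
    obtain ⟨w, hw, hwX⟩ := hX t ht
    rwa [← hwX (hstayK t ht)]
  have hXflow' : ∀ t ∈ Ioi (0 : ℝ), HasDerivAt X (-gradient F (X t)) t := fun t ht =>
    (hXflow t (le_of_lt ht)).hasDerivAt (Ici_mem_nhds ht)
  obtain ⟨z, hz⟩ : ∃ z, Tendsto X atTop (𝓝 z) := by
    refine exists_tendsto_of_norm_sub_le (G := fun t => F (X t) ^ (1 - θ) / D)
      (fun t ht => div_nonneg (hpow_nonneg (hstayK t ht)) hDpos.le) fun a b ha hab => ?_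
    rw [← sub_div]
    exact hlen a b ha hab fun t ht => hstayK t ht.1
  have hzK : z ∈ Metric.closedBall (0 : EuclideanSpace ℝ (Fin d)) (σ / 2) :=
    Metric.isClosed_closedBall.mem_of_tendsto hz <| by
      filter_upwards [eventually_ge_atTop 0] with t ht using hstayK t ht
  have hcrit : -gradient F z = 0 :=
    eq_zero_of_tendsto_of_tendsto_hasDerivWithinAt hXflow hz
      ((hgradc.continuousAt (hU.mem_nhds (hKU hzK))).neg.tendsto.comp hz)
  refine ⟨X, hXc, ?_, hX0, hXflow', fun t ht => mem_ball_zero_iff.2 (hstay t ht),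
    z, ⟨hKσ hzK, hKU hzK, ?_⟩, hz⟩
  · rw [show (1 : WithTop ℕ∞) = 0 + 1 by simp, contDiffOn_succ_iff_deriv_of_isOpen isOpen_Ioi]
    refine ⟨fun t ht => (hXflow' t ht).differentiableAt.differentiableWithinAt, by simp, ?_⟩
    rw [contDiffOn_zero]
    refine ContinuousOn.congr (f := fun t => -gradient F (X t)) ?_ fun t ht => (hXflow' t ht).deriv
    exact (hgradc.comp (hXc.mono Ioi_subset_Ici_self)
      fun t ht => hKU (hstayK t (le_of_lt ht))).neg
  · rw [← norm_eq_zero, ← norm_gradient, norm_eq_zero]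
    exact neg_eq_zero.1 hcrit
end

section
/- Let d ≥ 2 and 1 ≤ c ≤ d be integers, 𝕂 = ℝ or ℂ, U ⊆ 𝕂^d an open neighborhood of the origin, and E : U → 𝕂 a C¹ function of the form E(x) = F(x)·∏_{i=1}^c x_i^{n_i} with integers n_i ≥ 1 and F : U → 𝕂 a C¹ function with F(0) ≠ 0. Then there exists σ ∈ (0,1] with the closed ball of radius σ contained in U and F nonvanishing on B_σ, such that for all x ∈ B_σ with x_j ≠ 0 for j = 1,…,c: ‖E'(x)‖² ≥ (|F(x)|²/4) · (∏_{i=1}^c |x_i|^{2n_i}) · (∑_{j=1}^c |x_j|^{−2}). -/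
/-- The logarithmic derivative of a monomial: `d(∏ xᵢ^{nᵢ}) = (∏ xᵢ^{nᵢ}) ∑ nᵢ dxᵢ / xᵢ`. -/
theorem hasFDerivAt_prod_coord_pow {ι 𝕜 : Type*} [Fintype ι] [RCLike 𝕜]
    (s : Finset ι) (n : ι → ℕ) {x : EuclideanSpace 𝕜 ι} (hx : ∀ i ∈ s, x i ≠ 0) :
    HasFDerivAt (fun y : EuclideanSpace 𝕜 ι => ∏ i ∈ s, y i ^ n i)
      ((∏ i ∈ s, x i ^ n i) •
        ∑ i ∈ s, ((n i : 𝕜) / x i) • (EuclideanSpace.proj i : EuclideanSpace 𝕜 ι →L[𝕜] 𝕜)) x := by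
  classical
  have hcoord (i : ι) : HasFDerivAt (fun y : EuclideanSpace 𝕜 ι => y i)
      (EuclideanSpace.proj i : EuclideanSpace 𝕜 ι →L[𝕜] 𝕜) x :=
    (EuclideanSpace.proj i : EuclideanSpace 𝕜 ι →L[𝕜] 𝕜).hasFDerivAt
  refine (HasFDerivAt.finsetProd fun i _ => (hcoord i).pow (n i)).congr_fderiv ?_
  rw [Finset.smul_sum]
  refine Finset.sum_congr rfl fun i hi => ?_
  rw [smul_smul, smul_smul, ← Finset.mul_prod_erase s (fun j => x j ^ n j) hi]
  congr 1
  have := hx i hi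
  rcases Nat.eq_zero_or_pos (n i) with h | h
  · simp [h]
  · obtain ⟨k, hk⟩ := Nat.exists_eq_add_of_lt h
    simp only [hk, zero_add, Nat.add_sub_cancel, nsmul_eq_mul, pow_succ]
    field_simp

/-- The dual norm of a combination of coordinate functionals dominates the Euclidean norm of its
coefficients. -/
theorem sum_norm_sq_le_norm_sum_smul_proj_sq {ι 𝕜 : Type*} [Fintype ι] [RCLike 𝕜]
    (s : Finset ι) (a : ι → 𝕜) :
    ∑ i ∈ s, ‖a i‖ ^ 2 ≤
      ‖∑ i ∈ s, a i • (EuclideanSpace.proj i : EuclideanSpace 𝕜 ι →L[𝕜] 𝕜)‖ ^ 2 := by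
  classical
  let v : EuclideanSpace 𝕜 ι := WithLp.toLp 2 fun i => if i ∈ s then star (a i) else 0
  have hL : ∑ i ∈ s, a i • (EuclideanSpace.proj i : EuclideanSpace 𝕜 ι →L[𝕜] 𝕜) =
      innerSL 𝕜 v := by
    ext w
    simp [v, PiLp.inner_apply, apply_ite, mul_comm, Finset.sum_ite_mem]
  rw [hL, innerSL_apply_norm, EuclideanSpace.norm_sq_eq]
  simp [v, apply_ite, ite_pow, Finset.sum_ite_mem]

/-- **Pointwise lower bound on the gradient of a function with simple normal crossings.**
Let `d ≥ 2`, `1 ≤ c ≤ d`, and `E(x) = F(x)·∏_{i<c} xᵢ^{nᵢ}` on a neighborhood `U` of the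
origin in `𝕜^d`, with integers `nᵢ ≥ 1` and `F` of class `C¹` with `F(0) ≠ 0`. Then there
is `σ ∈ (0,1]` with the closed ball of radius `σ` contained in `U` and `F` nonvanishing on
`B_σ`, such that for all `x ∈ B_σ` with `xⱼ ≠ 0` for all `j < c`:
`‖E'(x)‖² ≥ (|F(x)|²/4) · (∏_{i<c} |xᵢ|^{2nᵢ}) · (∑_{j<c} |xⱼ|^{−2})`. -/
theorem gradient_squared_lower_bound_normal_crossings
    (d c : ℕ) (hd : 2 ≤ d) (hc1 : 1 ≤ c) (hcd : c ≤ d) (𝕜 : Type) [RCLike 𝕜]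
    (U : Set (EuclideanSpace 𝕜 (Fin d))) (hU : IsOpen U)
    (hU0 : (0 : EuclideanSpace 𝕜 (Fin d)) ∈ U)
    (E F : EuclideanSpace 𝕜 (Fin d) → 𝕜) (n : Fin d → ℕ)
    (hF : ContDiffOn 𝕜 1 F U) (hF0 : F 0 ≠ 0)
    (hn : ∀ i : Fin d, (i : ℕ) < c → 1 ≤ n i)
    (hform : ∀ x ∈ U, E x =
      F x * ∏ i ∈ Finset.univ.filter (fun i : Fin d => (i : ℕ) < c), (x i) ^ (n i)) :
    ∃ σ ∈ Set.Ioc (0:ℝ) 1,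
      Metric.closedBall (0 : EuclideanSpace 𝕜 (Fin d)) σ ⊆ U ∧
      (∀ x ∈ Metric.ball (0 : EuclideanSpace 𝕜 (Fin d)) σ, F x ≠ 0) ∧
      ∀ x ∈ Metric.ball (0 : EuclideanSpace 𝕜 (Fin d)) σ,
        (∀ i : Fin d, (i : ℕ) < c → x i ≠ 0) →
        ‖fderiv 𝕜 E x‖ ^ 2 ≥ (‖F x‖ ^ 2 / 4) *
          (∏ i ∈ Finset.univ.filter (fun i : Fin d => (i : ℕ) < c), ‖x i‖ ^ (2 * n i)) *
          (∑ j ∈ Finset.univ.filter (fun j : Fin d => (j : ℕ) < c), ‖x j‖ ^ (-2 : ℤ)) := by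
  have hFd : ∀ x ∈ U, DifferentiableAt 𝕜 F x := fun x hx =>
    (hF.differentiableOn one_ne_zero).differentiableAt (hU.mem_nhds hx)
  have hF'c : ContinuousAt (fderiv 𝕜 F) 0 :=
    (hF.continuousOn_fderiv_of_isOpen hU le_rfl).continuousAt (hU.mem_nhds hU0)
  have hm : 0 < ‖F 0‖ := norm_pos_iff.2 hF0
  set M : ℝ := ‖fderiv 𝕜 F 0‖ + 1 with hM
  have hM0 : 0 < M := by positivity
  obtain ⟨ε, hε, hball⟩ := Metric.eventually_nhds_iff_ball.1
    ((hU.eventually_mem hU0).and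
      (((hFd 0 hU0).continuousAt.norm.eventually_const_lt (half_lt_self hm)).and
        (hF'c.norm.eventually_lt_const (lt_add_one ‖fderiv 𝕜 F 0‖))))
  set σ : ℝ := min (ε / 2) (min 1 (‖F 0‖ / (4 * M))) with hσ
  have hσ0 : 0 < σ := by positivity
  have hσε : σ < ε := (min_le_left _ _).trans_lt (half_lt_self hε)
  have hσ1 : σ ≤ 1 := (min_le_right _ _).trans (min_le_left _ _)
  have hσM : 4 * M * σ ≤ ‖F 0‖ := by
    have h : σ ≤ ‖F 0‖ / (4 * M) := (min_le_right _ _).trans (min_le_right _ _)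
    rwa [le_div_iff₀ (by positivity), mul_comm] at h
  refine ⟨σ, ⟨hσ0, hσ1⟩, fun x hx => (hball x (Metric.closedBall_subset_ball hσε hx)).1,
    fun x hx => norm_pos_iff.1 ((half_pos hm).trans
      (hball x (Metric.ball_subset_ball hσε.le hx)).2.1), fun x hx hx0 => ?_⟩
  obtain ⟨hxU, hFx, hF'x⟩ := hball x (Metric.ball_subset_ball hσε.le hx)
  set s := Finset.univ.filter fun i : Fin d => (i : ℕ) < c with hs
  have hxs : ∀ i ∈ s, x i ≠ 0 := fun i hi => hx0 i (Finset.mem_filter.1 hi).2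
  set P : 𝕜 := ∏ i ∈ s, x i ^ n i with hP
  set L : EuclideanSpace 𝕜 (Fin d) →L[𝕜] 𝕜 :=
    ∑ i ∈ s, ((n i : 𝕜) / x i) • (EuclideanSpace.proj i : EuclideanSpace 𝕜 (Fin d) →L[𝕜] 𝕜)
    with hL
  set S : ℝ := ∑ j ∈ s, ‖x j‖ ^ (-2 : ℤ) with hS
  have hE : fderiv 𝕜 E x = P • (F x • L + fderiv 𝕜 F x) := by
    have h := (hFd x hxU).hasFDerivAt.mul (hasFDerivAt_prod_coord_pow s n hxs)
    have hEq : E =ᶠ[nhds x] fun y => F y * ∏ i ∈ s, y i ^ n i :=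
      Filter.eventually_of_mem (hU.mem_nhds hxU) hform
    rw [(h.congr_of_eventuallyEq hEq).fderiv, smul_add, smul_smul, smul_smul, mul_comm P]
  have hSL : S ≤ ‖L‖ ^ 2 := by
    refine le_trans (Finset.sum_le_sum fun j hj => ?_)
      (sum_norm_sq_le_norm_sum_smul_proj_sq s fun i => (n i : 𝕜) / x i)
    have hnj : (1 : ℝ) ≤ n j := by exact_mod_cast hn j (Finset.mem_filter.1 hj).2
    rw [norm_div, RCLike.norm_natCast, div_pow, zpow_neg, div_eq_mul_inv]
    exact le_mul_of_one_le_left (by positivity) (one_le_pow₀ hnj)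
  have hσS : (σ⁻¹) ^ 2 ≤ S := by
    have hj : (⟨0, by omega⟩ : Fin d) ∈ s := Finset.mem_filter.2 ⟨Finset.mem_univ _, hc1⟩
    refine le_trans ?_ (Finset.single_le_sum (f := fun j => ‖x j‖ ^ (-2 : ℤ))
      (fun i _ => by positivity) hj)
    have hpos := norm_pos_iff.2 (hxs _ hj)
    have hle : ‖x ⟨0, by omega⟩‖ ≤ σ :=
      (PiLp.norm_apply_le x _).trans (mem_ball_zero_iff.1 hx).le
    rw [zpow_neg, inv_pow]
    exact inv_anti₀ (by positivity) (pow_le_pow_left₀ hpos.le hle 2)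
  have hσL : σ⁻¹ ≤ ‖L‖ :=
    (sq_le_sq₀ (by positivity) (norm_nonneg _)).1 (hσS.trans hSL)
  have hF'L : ‖fderiv 𝕜 F x‖ ≤ ‖F x‖ * ‖L‖ / 2 := by
    have h1 : 2 * M ≤ ‖F x‖ * σ⁻¹ := by
      rw [← div_eq_mul_inv, le_div_iff₀ hσ0]
      linarith
    have h2 := mul_le_mul_of_nonneg_left hσL (norm_nonneg (F x))
    linarith
  have hlow : ‖F x‖ * ‖L‖ / 2 ≤ ‖F x • L + fderiv 𝕜 F x‖ := by
    have h := norm_sub_le_norm_add (F x • L) (fderiv 𝕜 F x)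
    rw [norm_smul] at h
    linarith
  have hPn : ∏ i ∈ s, ‖x i‖ ^ (2 * n i) = ‖P‖ ^ 2 := by
    simp only [hP, norm_prod, norm_pow, ← Finset.prod_pow, ← pow_mul, mul_comm]
  rw [hE, norm_smul, mul_pow, hPn, ge_iff_le]
  calc ‖F x‖ ^ 2 / 4 * ‖P‖ ^ 2 * S ≤ ‖F x‖ ^ 2 / 4 * ‖P‖ ^ 2 * ‖L‖ ^ 2 := by gcongr
    _ = ‖P‖ ^ 2 * (‖F x‖ * ‖L‖ / 2) ^ 2 := by ring
    _ ≤ ‖P‖ ^ 2 * ‖F x • L + fderiv 𝕜 F x‖ ^ 2 := by gcongr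
end

section
/- Let f : ℝ² → ℝ be the cusp polynomial f(x,y) = x² − y³. Then there exist constants C ∈ (0,∞) and σ ∈ (0,1] such that ‖∇f(x,y)‖ ≥ C · |x² − y³|^{2/3} for all (x,y) in the open ball of radius σ centered at the origin; that is, f satisfies the Łojasiewicz gradient inequality at the origin with exponent θ = 2/3. -/
theorem hasGradientAt_cusp (p : EuclideanSpace ℝ (Fin 2)) :
    HasGradientAt (fun q : EuclideanSpace ℝ (Fin 2) => (q 0) ^ 2 - (q 1) ^ 3)
      !₂[2 * p 0, -(3 * (p 1) ^ 2)] p := by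
  rw [hasGradientAt_iff_hasFDerivAt]
  have hproj (i : Fin 2) : HasFDerivAt (fun q : EuclideanSpace ℝ (Fin 2) => q i)
      (EuclideanSpace.proj i : EuclideanSpace ℝ (Fin 2) →L[ℝ] ℝ) p :=
    (EuclideanSpace.proj i : EuclideanSpace ℝ (Fin 2) →L[ℝ] ℝ).hasFDerivAt
  refine (((hproj 0).pow 2).sub ((hproj 1).pow 3)).congr_fderiv ?_
  ext v
  simp [InnerProductSpace.toDual_apply_apply, PiLp.inner_apply, Fin.sum_univ_two]
  ring

theorem sq_cusp_le_cube {x y t : ℝ} (ht : 0 ≤ t) (hx : |x| ≤ 1)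
    (hxt : 2 * |x| ≤ t) (hyt : 3 * y ^ 2 ≤ t) : (x ^ 2 - y ^ 3) ^ 2 ≤ t ^ 3 := by
  have hx4 : x ^ 4 ≤ |x| ^ 3 := by
    rw [← Even.pow_abs (by decide : Even 4)]
    exact pow_le_pow_of_le_one (abs_nonneg x) hx (by norm_num)
  have hx3 : (2 * |x|) ^ 3 ≤ t ^ 3 := by gcongr
  have hy3 : (3 * y ^ 2) ^ 3 ≤ t ^ 3 := by gcongr
  have ht3 : 0 ≤ t ^ 3 := by positivity
  nlinarith [sq_nonneg (x ^ 2 + y ^ 3)]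

/-- **Łojasiewicz gradient inequality for the cusp polynomial.** The function
`f(x,y) = x² − y³` on `ℝ²` satisfies the Łojasiewicz gradient inequality at the origin with
exponent `θ = 2/3`: there are `C ∈ (0,∞)` and `σ ∈ (0,1]` such that
`‖∇f(x,y)‖ ≥ C · |x² − y³|^{2/3}` on the ball of radius `σ` about the origin. -/
theorem cusp_lojasiewicz_gradient_inequality :
    ∃ C : ℝ, 0 < C ∧ ∃ σ ∈ Set.Ioc (0:ℝ) 1,
      ∀ p ∈ Metric.ball (0 : EuclideanSpace ℝ (Fin 2)) σ,
        ‖gradient (fun q : EuclideanSpace ℝ (Fin 2) => (q 0) ^ 2 - (q 1) ^ 3) p‖ ≥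
          C * |(p 0) ^ 2 - (p 1) ^ 3| ^ ((2:ℝ)/3) := by
  refine ⟨1, one_pos, 1, by simp, fun p hp => ?_⟩
  rw [(hasGradientAt_cusp p).gradient, one_mul, ge_iff_le]
  set g : EuclideanSpace ℝ (Fin 2) := !₂[2 * p 0, -(3 * (p 1) ^ 2)] with hg
  have hx : |p 0| ≤ 1 := (PiLp.norm_apply_le p 0).trans (mem_ball_zero_iff.mp hp).le
  have hxt : 2 * |p 0| ≤ ‖g‖ := by simpa [hg] using PiLp.norm_apply_le g 0
  have hyt : 3 * (p 1) ^ 2 ≤ ‖g‖ := by simpa [hg] using PiLp.norm_apply_le g 1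
  have hcube := sq_cusp_le_cube (norm_nonneg g) hx hxt hyt
  refine le_of_pow_le_pow_left₀ three_ne_zero (norm_nonneg g) ?_
  rw [← Real.rpow_mul_natCast (abs_nonneg _)]
  norm_num
  exact hcube
end
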